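/- arXiv:1006.2671 — 2 statements merged into one kernel-verified Lean document; each statement's English description precedes it below -/
import Mathlib

section
/- Let d ≥ 1 and assume that DHL(d) holds. Let T⃗ = (T_1,…,T_d) be a vector homogeneous tree, W a homogeneous tree, 0 < ε ≤ 1 and D : ⊗T⃗ → 2^W an ε-dense level selection. Then there exist a vector strong subtree S⃗ of T⃗ and, for every s⃗ ∈ ⊗S⃗, a node w_{s⃗} ∈ W and a constant 0 < θ_{s⃗} ≤ 1 with the following property: for every s⃗ ∈ ⊗S⃗ and every vector strong subtree Z⃗ of Suc_{S⃗}(s⃗) with root tuple s⃗, the pair (Z⃗, w_{s⃗}) is strongly θ_{s⃗}-correlated with respect to D. -/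
open Filter

namespace DHLPaper

/-- The tree `b^{<ℕ}` of all finite sequences with values in `{0,…,b−1}`,
partially ordered by end-extension (`List.IsPrefix`, written `<+:`). -/
def bSeq (b : ℕ) : Set (List ℕ) := {t | ∀ x ∈ t, x < b}

/-- The set of successors of `t` in `T`: `Suc_T(t) = {s ∈ T : t ≤ s}`. -/
def suc (T : Set (List ℕ)) (t : List ℕ) : Set (List ℕ) := {s ∈ T | t <+: s}

/-- `s` is an immediate successor of `t` in `T`. -/
def ImmSuc (T : Set (List ℕ)) (t s : List ℕ) : Prop :=
  t ∈ T ∧ s ∈ T ∧ t <+: s ∧ t ≠ s ∧ ∀ u ∈ T, t <+: u → u <+: s → u = t ∨ u = s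

/-- The `n`-th level of `T`: the nodes of `T` with exactly `n` strict predecessors in `T`. -/
def level (T : Set (List ℕ)) (n : ℕ) : Set (List ℕ) :=
  {t ∈ T | {s ∈ T | s <+: t ∧ s ≠ t}.ncard = n}

/-- `T` has exactly one minimal node. -/
def UniquelyRooted (T : Set (List ℕ)) : Prop := ∃! r, r ∈ level T 0

/-- Every node of `T` has finitely many immediate successors in `T`. -/
def FinitelyBranching (T : Set (List ℕ)) : Prop := ∀ t ∈ T, {s | ImmSuc T t s}.Finite

/-- Every node of `T` has at least one immediate successor in `T`. -/
def Pruned (T : Set (List ℕ)) : Prop := ∀ t ∈ T, ∃ s, ImmSuc T t s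

/-- `S` is a strong subtree of `T` whose level set `L_T(S)` is enumerated by the strictly
increasing map `l`: `S(n) ⊆ T(l n)` for every `n`, `S` is uniquely rooted, and for every
`s ∈ S` and every immediate successor `t` of `s` in `T` there is a unique immediate
successor `s'` of `s` in `S` with `t ≤ s'`. -/
def IsStrongSubtreeWith (T S : Set (List ℕ)) (l : ℕ → ℕ) : Prop :=
  S ⊆ T ∧ UniquelyRooted S ∧ StrictMono l ∧
    (∀ n, level S n ⊆ level T (l n)) ∧
    (∀ s ∈ S, ∀ t, ImmSuc T s t → ∃! s', ImmSuc S s s' ∧ t <+: s')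

/-- `S` is a strong subtree of `T`. -/
def IsStrongSubtree (T S : Set (List ℕ)) : Prop := ∃ l, IsStrongSubtreeWith T S l

/-- A homogeneous tree with branching number `b`: a strong subtree of `b^{<ℕ}`, `b ≥ 2`. -/
def IsHomogeneous (b : ℕ) (T : Set (List ℕ)) : Prop := 2 ≤ b ∧ IsStrongSubtree (bSeq b) T

/-- A vector homogeneous tree: a `d`-tuple of homogeneous trees. -/
def IsVecHomogeneous {d : ℕ} (b : Fin d → ℕ) (T : Fin d → Set (List ℕ)) : Prop :=
  ∀ i, IsHomogeneous (b i) (T i)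

/-- Vector strong subtree: componentwise strong subtrees with a common level set. -/
def IsVecStrongSubtree {d : ℕ} (T S : Fin d → Set (List ℕ)) : Prop :=
  ∃ l, ∀ i, IsStrongSubtreeWith (T i) (S i) l

/-- `⊗T(n) = T_1(n) × ⋯ × T_d(n)`. -/
def vecLevel {d : ℕ} (T : Fin d → Set (List ℕ)) (n : ℕ) : Set (Fin d → List ℕ) :=
  {v | ∀ i, v i ∈ level (T i) n}

/-- The level product `⊗T = ⋃_n ⊗T(n)`. -/
def levelProd {d : ℕ} (T : Fin d → Set (List ℕ)) : Set (Fin d → List ℕ) :=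
  ⋃ n, vecLevel T n

/-- `r` is the root tuple of the vector tree `T`. -/
def IsRoot {d : ℕ} (T : Fin d → Set (List ℕ)) (r : Fin d → List ℕ) : Prop :=
  ∀ i, level (T i) 0 = {r i}

/-- `F` is a vector fan of `T`: `F = (R_1(0) ∪ R_1(1), …, R_d(0) ∪ R_d(1))` for some
vector strong subtree `R` of `T`. -/
def IsVecFan {d : ℕ} (T F : Fin d → Set (List ℕ)) : Prop :=
  ∃ R : Fin d → Set (List ℕ), IsVecStrongSubtree T R ∧
    ∀ i, F i = level (R i) 0 ∪ level (R i) 1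

/-- `fan(T,n)`: the vector fans of `T` with `⊗F(1) ⊆ ⊗T(n)`. -/
def fanAt {d : ℕ} (T : Fin d → Set (List ℕ)) (n : ℕ) : Set (Fin d → Set (List ℕ)) :=
  {F | IsVecFan T F ∧ vecLevel F 1 ⊆ vecLevel T n}

/-- Density of `F ⊆ W(n)` in the `n`-th level of `W`. -/
noncomputable def dens (W : Set (List ℕ)) (n : ℕ) (F : Set (List ℕ)) : ℝ :=
  (F.ncard : ℝ) / ((level W n).ncard : ℝ)

/-- Density of `F ⊆ W(n)` relative to the node `w`. -/
noncomputable def densRel (W : Set (List ℕ)) (n : ℕ) (F : Set (List ℕ)) (w : List ℕ) : ℝ :=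
  ((F ∩ suc W w).ncard : ℝ) / ((level W n ∩ suc W w).ncard : ℝ)

/-- `s = w ⌢_W p`: `s` is the immediate successor of `w` in `W` such that the
concatenation `w ⌢ p` is an initial segment of `s`. -/
def IsConcat (W : Set (List ℕ)) (w : List ℕ) (p : ℕ) (s : List ℕ) : Prop :=
  ImmSuc W w s ∧ w ++ [p] <+: s

/-- The density Halpern–Läuchli statement in dimension `d`. -/
def DHL (d : ℕ) : Prop :=
  ∀ (b : Fin d → ℕ) (T : Fin d → Set (List ℕ)), IsVecHomogeneous b T →
    ∀ D : Set (Fin d → List ℕ), D ⊆ levelProd T →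
      0 < Filter.limsup
          (fun n => ((D ∩ vecLevel T n).ncard : ℝ) / ((vecLevel T n).ncard : ℝ)) atTop →
      ∃ S : Fin d → Set (List ℕ), IsVecStrongSubtree T S ∧ levelProd S ⊆ D

/-- `D : ⊗T → 2^W` is an `ε`-dense level selection along the strictly increasing
sequence `l`: for every `n` and every `t⃗ ∈ ⊗T(n)`, `D(t⃗) ⊆ W(l n)` and
`dens(D(t⃗)) ≥ ε`. -/
def IsDenseLevelSel {d : ℕ} (T : Fin d → Set (List ℕ)) (W : Set (List ℕ)) (l : ℕ → ℕ)
    (ε : ℝ) (D : (Fin d → List ℕ) → Set (List ℕ)) : Prop :=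
  StrictMono l ∧ ∀ n, ∀ v ∈ vecLevel T n, D v ⊆ level W (l n) ∧ ε ≤ dens W (l n) (D v)

/-- The pair `(R, w)` (`R` a vector strong subtree of `T` with root tuple `r0`) is strongly
`θ`-correlated with respect to the dense level selection `D` (with level sequence `l`):
`w ∈ D(r0)` and for every vector fan `F` of `R` with `F(0) = r0` and every `p < b_W`,
`dens(⋂_{r ∈ ⊗F(1)} D(r) | w ⌢_W p) ≥ θ`. -/
def StronglyCorrelated {d : ℕ} (T : Fin d → Set (List ℕ)) (W : Set (List ℕ)) (bW : ℕ)
    (l : ℕ → ℕ) (D : (Fin d → List ℕ) → Set (List ℕ)) (R : Fin d → Set (List ℕ))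
    (r0 : Fin d → List ℕ) (w : List ℕ) (θ : ℝ) : Prop :=
  w ∈ D r0 ∧
    ∀ F : Fin d → Set (List ℕ), IsVecFan R F → IsRoot F r0 →
      ∀ n, vecLevel F 1 ⊆ vecLevel T n →
        ∀ p < bW, ∀ s, IsConcat W w p s →
          θ ≤ densRel W (l n) (⋂ r ∈ vecLevel F 1, D r) s

section Ultrafilters

attribute [local instance] Ultrafilter.mul Ultrafilter.semigroup

/-- A compact right-topological semigroup has a closed left ideal in which every idempotent is a
right identity. -/
theorem exists_leftIdeal_idempotent_right_identity {M : Type*} [Nonempty M] [Semigroup M]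
    [TopologicalSpace M] [CompactSpace M] [T2Space M] (hM : ∀ r : M, Continuous (· * r)) :
    ∃ L : Set M, L.Nonempty ∧ (∀ x ∈ L, ∀ y, y * x ∈ L) ∧
      ∀ e ∈ L, ∀ f ∈ L, f * f = f → e * f = e := by
  let I : Set (Set M) := {N | IsClosed N ∧ N.Nonempty ∧ ∀ x ∈ N, ∀ y, y * x ∈ N}
  obtain ⟨L, hL⟩ : ∃ L, Minimal (· ∈ I) L := by
    refine zorn_superset _ fun c hcs hc => ?_
    refine ⟨⋂₀ c, ⟨isClosed_sInter fun t ht => (hcs ht).1, ?_, fun x hx y => ?_⟩,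
      fun s hs => Set.sInter_subset_of_mem hs⟩
    · obtain rfl | hcn := c.eq_empty_or_nonempty
      · rw [Set.sInter_empty]
        exact Set.univ_nonempty
      have := hcn.coe_sort
      rw [Set.sInter_eq_iInter]
      exact IsCompact.nonempty_iInter_of_directed_nonempty_isCompact_isClosed
        ((↑) : c → Set M) (DirectedOn.directed_val (IsChain.directedOn hc.symm))
        (fun i => (hcs i.prop).2.1) (fun i => (hcs i.prop).1.isCompact)
        (fun i => (hcs i.prop).1)
    · rw [Set.mem_sInter]
      exact fun t ht => (hcs ht).2.2 x (Set.mem_sInter.mp hx t ht) y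
  refine ⟨L, hL.prop.2.1, hL.prop.2.2, fun e he f hf hff => ?_⟩
  have hLf : (· * f) '' Set.univ = L := by
    apply hL.eq_of_subset
    · refine ⟨(hM f).isClosedMap _ isClosed_univ, ⟨_, ⟨f, trivial, rfl⟩⟩, ?_⟩
      rintro _ ⟨g, -, rfl⟩ y
      exact ⟨y * g, trivial, mul_assoc _ _ _⟩
    · rintro _ ⟨g, -, rfl⟩
      exact hL.prop.2.2 f hf g
  rw [← hLf] at he
  obtain ⟨g, -, rfl⟩ := he
  simp only [mul_assoc, hff]

theorem ultrafilter_map_mul {M N : Type*} [Mul M] [Mul N] (f : M →ₙ* N)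
    (u v : Ultrafilter M) : (u * v).map f = u.map f * v.map f := by
  refine Ultrafilter.coe_inj.1 (Filter.ext fun s => ?_)
  change (∀ᶠ x in ((u * v : Ultrafilter M) : Filter M), f x ∈ s) ↔
    ∀ᶠ x in ((u.map f * v.map f : Ultrafilter N) : Filter N), x ∈ s
  rw [Ultrafilter.eventually_mul, Ultrafilter.eventually_mul]
  simp only [Ultrafilter.coe_map, Filter.eventually_map, map_mul]

/-- Substitution of the letter `a` for the variable `none` in a variable word. -/
def substHom {A : Type*} (a : A) : FreeMonoid (Option A) →* FreeMonoid A :=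
  FreeMonoid.map fun o => o.getD a

/-- There is an ultrafilter of left variable words all of whose substitution instances absorb one
another. -/
theorem exists_ultrafilter_leftVariable (A : Type*) :
    ∃ q : Ultrafilter (FreeMonoid (Option A)),
      (∀ᶠ v in (q : Filter (FreeMonoid (Option A))), ∃ u, v = FreeMonoid.of none * u) ∧
      ∀ a a' : A, q.map (substHom a) * q.map (substHom a') = q.map (substHom a) := by
  obtain ⟨L, ⟨p, hp⟩, hL, hLi⟩ := exists_leftIdeal_idempotent_right_identity
    (M := Ultrafilter (FreeMonoid A)) Ultrafilter.continuous_mul_left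
  let ι : FreeMonoid A →* FreeMonoid (Option A) := FreeMonoid.map some
  have hι : ∀ a, substHom a ∘ ι = id := by
    intro a
    funext w
    change (FreeMonoid.map (fun o : Option A => o.getD a)) (FreeMonoid.map some w) = w
    rw [FreeMonoid.map_map]
    exact List.map_id _
  let V : Set (FreeMonoid (Option A)) := {v | ∃ u, v = FreeMonoid.of none * u}
  let K : Set (Ultrafilter (FreeMonoid (Option A))) := (· * p.map ι) '' {u | V ∈ u}
  have hV : ∀ u w : Ultrafilter (FreeMonoid (Option A)), V ∈ u → V ∈ u * w := by
    intro u w hu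
    change ∀ᶠ x in ((u * w : Ultrafilter _) : Filter _), x ∈ V
    rw [Ultrafilter.eventually_mul]
    filter_upwards [hu] with x hx
    obtain ⟨y, rfl⟩ := hx
    exact Filter.Eventually.of_forall fun z => ⟨y * z, mul_assoc _ _ _⟩
  obtain ⟨q, ⟨v, hv, hvq⟩, hq⟩ := exists_idempotent_in_compact_subsemigroup
    (M := Ultrafilter (FreeMonoid (Option A))) Ultrafilter.continuous_mul_left K
    ⟨_, ⟨pure (FreeMonoid.of none), ⟨1, (mul_one _).symm⟩, rfl⟩⟩
    ((ultrafilter_isClosed_basic V).isCompact.image (Ultrafilter.continuous_mul_left _))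
    (by
      rintro _ ⟨u, hu, rfl⟩ _ ⟨w, hw, rfl⟩
      exact ⟨u * (p.map ι * w), hV _ _ hu, by simp only [mul_assoc]⟩)
  refine ⟨q, by rw [← hvq]; exact hV _ _ hv, ?_⟩
  have hqL : ∀ a, q.map (substHom a) ∈ L := by
    intro a
    have h1 : q.map (substHom a) = v.map (substHom a) * p := by
      rw [← hvq]
      have := ultrafilter_map_mul ((substHom a : FreeMonoid (Option A) →* FreeMonoid A) :
        FreeMonoid (Option A) →ₙ* FreeMonoid A) v (p.map ι)
      refine this.trans ?_
      congr 1
      change (p.map ι).map (substHom a) = p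
      rw [Ultrafilter.map_map, hι, Ultrafilter.map_id]
    rw [h1]
    exact hL p hp _
  intro a a'
  refine hLi _ (hqL a) _ (hqL a') ?_
  have := ultrafilter_map_mul ((substHom a' : FreeMonoid (Option A) →* FreeMonoid A) :
        FreeMonoid (Option A) →ₙ* FreeMonoid A) q q
  rw [hq] at this
  exact this.symm

/-- The word `w ⌢ v 0 (a 0) ⌢ v 1 (a 1) ⌢ ⋯` obtained from a constant word `w` and a sequence `v` of
variable words by substituting the letters of a given word. -/
def substWord {A : Type*} (w : List A) (v : ℕ → List (Option A)) : List A → List A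
  | [] => w
  | a :: as => substWord (w ++ (v 0).map fun o => o.getD a) (fun k => v (k + 1)) as

theorem substWord_append_singleton {A : Type*} (w : List A) (v : ℕ → List (Option A))
    (as : List A) (a : A) :
    substWord w v (as ++ [a]) = substWord w v as ++ (v as.length).map fun o => o.getD a := by
  induction as generalizing w v with
  | nil => rfl
  | cons c as ih => simp only [List.cons_append, substWord, ih, List.length_cons]

theorem map_substWord {A A' : Type*} (f : A → A') (w : List A) (v : ℕ → List (Option A))
    (as : List A) :
    (substWord w v as).map f =
      substWord (w.map f) (fun k => (v k).map (Option.map f)) (as.map f) := by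
  induction as generalizing w v with
  | nil => rfl
  | cons c as ih =>
    simp only [List.map_cons, substWord, ih, List.map_append, List.map_map]
    congr 2
    refine List.map_congr_left fun o _ => ?_
    cases o <;> rfl

theorem length_substWord {A : Type*} (w : List A) (v : ℕ → List (Option A)) (as : List A) :
    (substWord w v as).length =
      w.length + ∑ k ∈ Finset.range as.length, (v k).length := by
  induction as using List.reverseRecOn with
  | nil => simp [substWord]
  | append_singleton as a ih =>
    rw [substWord_append_singleton]
    simp [ih, Finset.sum_range_succ, add_assoc]

/-- Carlson–Simpson theorem: every finite colouring of the words over a finite alphabet is constant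
on an infinite Carlson–Simpson tree. -/
theorem exists_monochromatic_substWord {A κ : Type*} [Finite A] [Nonempty A] (χ : List A → κ)
    (hχ : (Set.range χ).Finite) :
    ∃ (w : List A) (v : ℕ → List (Option A)), (∀ k, ∃ u, v k = none :: u) ∧
      ∃ κ₀, ∀ as, χ (substWord w v as) = κ₀ := by
  obtain ⟨q, hqV, hq⟩ := exists_ultrafilter_leftVariable A
  let Q : A → Ultrafilter (FreeMonoid A) := fun a => q.map (substHom a)
  obtain ⟨a₀⟩ := ‹Nonempty A›
  let χ' : FreeMonoid A → κ := fun w => χ w.toList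
  obtain ⟨κ₀, -, hκ₀⟩ : ∃ c ∈ Set.range χ, ∀ᶠ w in (Q a₀ : Filter (FreeMonoid A)), χ' w = c := by
    exact (Ultrafilter.eventually_exists_mem_iff (f := Q a₀) hχ).1
      (Filter.Eventually.of_forall fun w => ⟨_, ⟨w.toList, rfl⟩, rfl⟩)
  let C : FreeMonoid A → Prop := fun w =>
    χ' w = κ₀ ∧ ∀ a, ∀ᶠ u in (Q a : Filter (FreeMonoid A)), χ' (w * u) = κ₀
  have hC0 : ∃ w, C w := by
    have h1 : ∀ a, ∀ᶠ w in (Q a₀ : Filter (FreeMonoid A)),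
        ∀ᶠ u in (Q a : Filter (FreeMonoid A)), χ' (w * u) = κ₀ := by
      intro a
      rw [← Ultrafilter.eventually_mul (Q a₀) (Q a) (fun x => χ' x = κ₀), hq a₀ a]
      exact hκ₀
    exact (hκ₀.and (Filter.eventually_all.2 h1)).exists
  have hCs : ∀ w, C w → ∀ᶠ v in (q : Filter (FreeMonoid (Option A))),
      ∀ a, C (w * substHom a v) := by
    intro w hw
    refine Filter.eventually_all.2 fun a => ?_
    change ∀ᶠ u in (Q a : Filter (FreeMonoid A)), C (w * u)
    refine (hw.2 a).and (Filter.eventually_all.2 fun a' => ?_)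
    have h2 := hw.2 a
    rw [show Q a = Q a * Q a' from (hq a a').symm, Ultrafilter.eventually_mul] at h2
    simpa only [mul_assoc] using h2
  have step : ∀ F : {F : Set (FreeMonoid A) // F.Finite ∧ ∀ w ∈ F, C w},
      ∃ v : FreeMonoid (Option A), (∃ u, v = FreeMonoid.of none * u) ∧
        ∀ w ∈ F.1, ∀ a, C (w * substHom a v) := by
    intro F
    exact (hqV.and ((Filter.eventually_all_finite F.2.1).2 fun w hw => hCs w (F.2.2 w hw))).exists
  choose next hnext using step
  obtain ⟨w₀, hw₀⟩ := hC0
  let Fs : ℕ → {F : Set (FreeMonoid A) // F.Finite ∧ ∀ w ∈ F, C w} := fun n =>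
    Nat.rec ⟨{w₀}, Set.finite_singleton _, by simpa using hw₀⟩
      (fun _ F => ⟨Set.image2 (fun w a => w * substHom a (next F)) F.1 Set.univ,
        F.2.1.image2 _ Set.finite_univ, by
          rintro _ ⟨w, hw, a, -, rfl⟩
          exact (hnext F).2 w hw a⟩) n
  let v : ℕ → List (Option A) := fun k => (next (Fs k)).toList
  have hmem : ∀ as : List A, FreeMonoid.ofList (substWord w₀.toList v as) ∈ (Fs as.length).1 := by
    intro as
    induction as using List.reverseRecOn with
    | nil => exact Set.mem_singleton _
    | append_singleton as a ih =>
      rw [substWord_append_singleton, List.length_append]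
      exact ⟨_, ih, a, trivial, rfl⟩
  refine ⟨w₀.toList, v, fun k => ?_, κ₀, fun as => ?_⟩
  · obtain ⟨u, hu⟩ := (hnext (Fs k)).1
    exact ⟨u.toList, congrArg FreeMonoid.toList hu⟩
  · exact ((Fs as.length).2.2 _ (hmem as)).1

/-- `σ` embeds the tree of words over `B` into itself as a strong subtree with level set enumerated
by `l`. -/
def TreeEmb {B : Type*} (l : ℕ → ℕ) (σ : List B → List B) : Prop :=
  (∀ t, (σ t).length = l t.length) ∧ ∀ t c, σ t ++ [c] <+: σ (t ++ [c])

/-- All words of the tuple `t` have length `n`. -/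
def HasLength {J : Type*} {B : J → Type*} (n : ℕ) (t : ∀ j, List (B j)) : Prop :=
  ∀ j, (t j).length = n

theorem TreeEmb.id {B : Type*} : TreeEmb (fun n => n) (fun t : List B => t) :=
  ⟨fun _ => rfl, fun _ _ => List.prefix_refl _⟩

theorem TreeEmb.mono {B : Type*} {l : ℕ → ℕ} {σ : List B → List B} (h : TreeEmb l σ)
    {s t : List B} (hst : s <+: t) : σ s <+: σ t := by
  obtain ⟨u, rfl⟩ := hst
  induction u using List.reverseRecOn with
  | nil => simp
  | append_singleton u c ih =>
    rw [← List.append_assoc]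
    exact ih.trans ((List.prefix_append _ _).trans (h.2 _ _))

theorem TreeEmb.append_singleton_prefix {B : Type*} {l : ℕ → ℕ} {σ : List B → List B}
    (h : TreeEmb l σ) {s t : List B} {c : B} (hst : s ++ [c] <+: t) : σ s ++ [c] <+: σ t :=
  (h.2 s c).trans (h.mono hst)

theorem TreeEmb.comp {B : Type*} {l m : ℕ → ℕ} {σ τ : List B → List B} (hσ : TreeEmb l σ)
    (hτ : TreeEmb m τ) : TreeEmb (fun n => l (m n)) (fun t => σ (τ t)) :=
  ⟨fun t => by rw [hσ.1, hτ.1], fun t c => hσ.append_singleton_prefix (hτ.2 t c)⟩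

theorem TreeEmb.strictMono {B : Type*} [Nonempty B] {l : ℕ → ℕ} {σ : List B → List B}
    (h : TreeEmb l σ) : StrictMono l := by
  obtain ⟨c⟩ := ‹Nonempty B›
  refine strictMono_nat_of_lt_succ fun n => ?_
  have := (h.2 (List.replicate n c) c).length_le
  simp only [List.length_append, h.1, List.length_replicate, List.length_singleton] at this
  omega

theorem HasLength.emb {J : Type*} {B : J → Type*} {n : ℕ} {t : ∀ j, List (B j)}
    (ht : HasLength n t) {l : ℕ → ℕ} {σ : ∀ j, List (B j) → List (B j)}
    (hσ : ∀ j, TreeEmb l (σ j)) : HasLength (l n) (fun j => σ j (t j)) :=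
  fun j => by rw [(hσ j).1, ht j]

theorem HasLength.exists_list {J : Type*} {B : J → Type*} {n : ℕ} {t : ∀ j, List (B j)}
    (ht : HasLength n t) : ∃ as : List (∀ j, B j), as.length = n ∧
      ∀ j, as.map (fun a => a j) = t j := by
  refine ⟨List.ofFn fun k : Fin n => fun j => (t j).get (k.cast (ht j).symm), by simp,
    fun j => ?_⟩
  apply List.ext_get
  · simp [ht j]
  · intro k h1 h2
    simp

/-- Halpern–Läuchli theorem for finitely many homogeneous trees, strong subtree version. -/
theorem exists_monochromatic_treeEmb {J κ : Type*} {B : J → Type*} [Finite J] [∀ j, Finite (B j)]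
    [∀ j, Nonempty (B j)] (χ : (∀ j, List (B j)) → κ) (C : Set κ) (hC : C.Finite)
    (hχ : ∀ n y, HasLength n y → χ y ∈ C) :
    ∃ (l : ℕ → ℕ) (σ : ∀ j, List (B j) → List (B j)), (∀ j, TreeEmb l (σ j)) ∧
      ∃ κ₀, ∀ n y, HasLength n y → χ (fun j => σ j (y j)) = κ₀ := by
  obtain ⟨w, v, hv, κ₀, hκ₀⟩ := exists_monochromatic_substWord
    (fun as : List (∀ j, B j) => χ fun j => as.map fun a => a j)
    (hC.subset (by
      rintro _ ⟨as, rfl⟩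
      exact hχ as.length _ fun j => by simp))
  refine ⟨fun n => w.length + ∑ k ∈ Finset.range n, (v k).length,
    fun j => substWord (w.map fun a => a j) fun k => (v k).map (Option.map fun a => a j),
    fun j => ⟨fun t => by simp [length_substWord], fun t c => ?_⟩, κ₀, fun n y hy => ?_⟩
  · beta_reduce
    rw [substWord_append_singleton]
    refine (List.prefix_append_right_inj _).2 ?_
    obtain ⟨u, hu⟩ := hv t.length
    simp [hu]
  · obtain ⟨as, -, has⟩ := hy.exists_list
    rw [← hκ₀ as]
    congr 1
    funext j
    rw [map_substWord, has]

end Ultrafilters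

/-- The words `g i c` form the first level of a vector fan with root tuple `t`, and they all have
length `m`. -/
def FanAt {I : Type*} {B : I → Type*} (t : ∀ i, List (B i)) (m : ℕ)
    (g : ∀ i, B i → List (B i)) : Prop :=
  ∀ i c, (g i c).length = m ∧ t i ++ [c] <+: g i c

theorem FanAt.emb {I : Type*} {B : I → Type*} {t : ∀ i, List (B i)} {m : ℕ}
    {g : ∀ i, B i → List (B i)} (hg : FanAt t m g) {l : ℕ → ℕ}
    {σ : ∀ i, List (B i) → List (B i)} (hσ : ∀ i, TreeEmb l (σ i)) :
    FanAt (fun i => σ i (t i)) (l m) (fun i c => σ i (g i c)) :=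
  fun i c => ⟨by rw [(hσ i).1, (hg i c).1], (hσ i).append_singleton_prefix (hg i c).2⟩

/-- Gluing a family of tree embeddings above the nodes of length `k`. -/
theorem TreeEmb.glue {B : Type*} (k : ℕ) {l : ℕ → ℕ} {σ : List B → List B → List B}
    (hσ : ∀ u, u.length = k → TreeEmb l (σ u)) (hσ' : ∀ u, u.length < k → σ u [] = []) :
    TreeEmb (fun m => if k ≤ m then k + l (m - k) else m)
      (fun t => t.take k ++ σ (t.take k) (t.drop k)) := by
  refine ⟨fun t => ?_, fun t c => ?_⟩
  · dsimp only
    split_ifs with h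
    · have hk : (t.take k).length = k := by simpa using h
      rw [List.length_append, (hσ _ hk).1, hk, List.length_drop]
    · push Not at h
      rw [List.take_of_length_le h.le, List.drop_of_length_le h.le, hσ' t h, List.append_nil]
  · dsimp only
    rcases lt_trichotomy (t.length + 1) k with h | h | h
    · rw [List.take_of_length_le (by omega), List.drop_of_length_le (by omega),
        hσ' t (by omega), List.append_nil]
      rw [List.take_of_length_le (by simpa using h.le)]
      exact List.prefix_append _ _
    · rw [List.take_of_length_le (by omega), List.drop_of_length_le (by omega),
        hσ' t (by omega), List.append_nil]
      rw [List.take_of_length_le (by simpa using h.le)]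
      exact List.prefix_append _ _
    · have hk : (t.take k).length = k := by simp; omega
      rw [List.take_append_of_le_length (by omega), List.drop_append_of_le_length (by omega),
        List.append_assoc]
      exact (List.prefix_append_right_inj _).2 ((hσ _ hk).2 _ _)

section Fusion

variable {I κ : Type*} {B : I → Type*} [Finite I] [∀ i, Finite (B i)] [∀ i, Nonempty (B i)]

/-- The colour of a fan can be made to depend only on its root tuple, for the root tuples of a given
length `n`, without changing the nodes of length at most `n`. -/
theorem exists_treeEmb_fan_homogeneous_at (n : ℕ)
    (χ : (∀ i, List (B i)) → (∀ i, B i → List (B i)) → κ)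
    (hχ : ∀ t, HasLength n t → (Set.range (χ t)).Finite) :
    ∃ (l : ℕ → ℕ) (ρ : ∀ i, List (B i) → List (B i)), (∀ i, TreeEmb l (ρ i)) ∧
      (∀ i t, t.length ≤ n → ρ i t = t) ∧
      ∀ t, HasLength n t → ∃ κ₀, ∀ m g, FanAt t m g → χ t (fun i c => ρ i (g i c)) = κ₀ := by
  have hfin : ∀ (i : I) (k : ℕ), Finite {u : List (B i) // u.length = k} := fun i k =>
    List.finite_length_eq (B i) k
  have hfin' : Finite {t : ∀ i, List (B i) // HasLength n t} := by
    have : ∀ i : I, Finite {u : List (B i) // u.length = n} := fun i => hfin i n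
    exact Finite.of_injective
      (fun (t : {t : ∀ i, List (B i) // HasLength n t}) (i : I) =>
        (⟨t.1 i, t.2 i⟩ : {u : List (B i) // u.length = n}))
      (fun s t hst => Subtype.ext (funext fun i => congrArg Subtype.val (congrFun hst i)))
  let J := Σ i : I, {u : List (B i) // u.length = n + 1}
  have : Finite J := by
    have : ∀ i : I, Finite {u : List (B i) // u.length = n + 1} := fun i => hfin i (n + 1)
    infer_instance
  let X : (∀ j : J, List (B j.1)) → {t : ∀ i, List (B i) // HasLength n t} → κ := fun y t =>
    χ t.1 fun i c => (t.1 i ++ [c]) ++ y ⟨i, t.1 i ++ [c], by simp [t.2 i]⟩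
  obtain ⟨l, σ, hσ, κ₀, hκ₀⟩ := exists_monochromatic_treeEmb X
    {f | ∀ t : {t : ∀ i, List (B i) // HasLength n t}, f t ∈ Set.range (χ t.1)}
    (Set.Finite.pi' fun t => hχ t.1 t.2)
    (fun _ y _ t => ⟨_, rfl⟩)
  let σ' : ∀ i, List (B i) → List (B i) → List (B i) := fun i u z =>
    if h : u.length = n + 1 then σ ⟨i, u, h⟩ z else z
  have hσ' : ∀ i u (h : u.length = n + 1), σ' i u = σ ⟨i, u, h⟩ := fun i u h => by
    funext z
    exact dif_pos h
  have hσ'' : ∀ i u, u.length < n + 1 → σ' i u [] = [] := fun i u h => dif_neg h.ne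
  refine ⟨_, fun i t => t.take (n + 1) ++ σ' i (t.take (n + 1)) (t.drop (n + 1)),
    fun i => TreeEmb.glue (n + 1) (l := l) (fun u hu => ?_) (hσ'' i), fun i t ht => ?_, fun t ht => ?_⟩
  · rw [hσ' i u hu]
    exact hσ ⟨i, u, hu⟩
  · dsimp only
    rw [List.take_of_length_le (by omega), List.drop_of_length_le (by omega),
      hσ'' i t (by omega), List.append_nil]
  · refine ⟨κ₀ ⟨t, ht⟩, fun m g hg => ?_⟩
    let y : ∀ j : J, List (B j.1) := fun j =>
      (g j.1 (j.2.1.getLast (List.ne_nil_of_length_eq_add_one j.2.2))).drop (n + 1)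
    have hy := congrFun (hκ₀ (m - (n + 1)) y fun j => by simp [y, (hg _ _).1]) ⟨t, ht⟩
    rw [← hy]
    refine congrArg (χ t) (funext fun i => funext fun c => ?_)
    have hlen : (t i ++ [c]).length = n + 1 := by simp [ht i]
    have htake : (g i c).take (n + 1) = t i ++ [c] := by
      rw [← hlen]
      exact (List.prefix_iff_eq_take.1 (hg i c).2).symm
    beta_reduce
    rw [htake, hσ' i _ hlen]
    simp [y]

/-- The colour of a fan can be made to depend only on its root tuple. -/
theorem exists_treeEmb_fan_homogeneous [Nonempty I]
    (χ : (∀ i, List (B i)) → (∀ i, B i → List (B i)) → κ)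
    (hχ : ∀ n t, HasLength n t → (Set.range (χ t)).Finite) :
    ∃ (l : ℕ → ℕ) (σ : ∀ i, List (B i) → List (B i)), (∀ i, TreeEmb l (σ i)) ∧
      ∀ n t, HasLength n t → ∃ κ₀, ∀ m g, FanAt t m g →
        χ (fun i => σ i (t i)) (fun i c => σ i (g i c)) = κ₀ := by
  let Emb := {p : (ℕ → ℕ) × (∀ i, List (B i) → List (B i)) // ∀ i, TreeEmb p.1 (p.2 i)}
  have step : ∀ (n : ℕ) (E : Emb), ∃ E' : Emb,
      (∃ (m : ℕ → ℕ) (ρ : ∀ i, List (B i) → List (B i)), (∀ i, TreeEmb m (ρ i)) ∧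
        (∀ i t, t.length ≤ n → ρ i t = t) ∧ ∀ i t, E'.1.2 i t = E.1.2 i (ρ i t)) ∧
      ∀ t, HasLength n t → ∃ κ₀, ∀ m g, FanAt t m g →
        χ (fun i => E'.1.2 i (t i)) (fun i c => E'.1.2 i (g i c)) = κ₀ := by
    intro n E
    obtain ⟨m, ρ, hρ, hid, hhom⟩ := exists_treeEmb_fan_homogeneous_at n
      (fun t g => χ (fun i => E.1.2 i (t i)) (fun i c => E.1.2 i (g i c)))
      (fun t ht => (hχ _ _ (ht.emb E.2)).subset (by rintro _ ⟨g, rfl⟩; exact ⟨_, rfl⟩))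
    refine ⟨⟨(fun k => E.1.1 (m k), fun i t => E.1.2 i (ρ i t)), fun i => (E.2 i).comp (hρ i)⟩,
      ⟨m, ρ, hρ, hid, fun _ _ => rfl⟩, fun t ht => ?_⟩
    obtain ⟨κ₀, h⟩ := hhom t ht
    refine ⟨κ₀, fun k g hg => ?_⟩
    rw [← h k g hg]
    dsimp only
    congr 1
    funext i
    rw [hid i _ (ht i).le]
  choose next hnext hhom using step
  let s : ℕ → Emb := fun n =>
    Nat.rec ⟨(fun n => n, fun _ t => t), fun _ => TreeEmb.id⟩ next n
  have hs : ∀ n k, ∃ (m : ℕ → ℕ) (ρ : ∀ i, List (B i) → List (B i)), (∀ i, TreeEmb m (ρ i)) ∧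
      (∀ i t, t.length ≤ n → ρ i t = t) ∧ ∀ i t, (s (n + k)).1.2 i t = (s n).1.2 i (ρ i t) := by
    intro n k
    induction k with
    | zero => exact ⟨_, _, fun i => TreeEmb.id, fun _ _ _ => rfl, fun _ _ => rfl⟩
    | succ k ih =>
      obtain ⟨m, ρ, hρ, hid, h⟩ := ih
      obtain ⟨m', ρ', hρ', hid', h'⟩ := hnext (n + k) (s (n + k))
      refine ⟨_, fun i t => ρ i (ρ' i t), fun i => (hρ i).comp (hρ' i), fun i t ht => ?_,
        fun i t => ?_⟩
      · beta_reduce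
        rw [hid' i t (by omega), hid i t ht]
      · rw [← h, ← h']
        rfl
  have hagree : ∀ i t n, t.length ≤ n → (s n).1.2 i t = (s t.length).1.2 i t := by
    intro i t n h
    obtain ⟨k, rfl⟩ := Nat.exists_eq_add_of_le h
    obtain ⟨m, ρ, -, hid, h⟩ := hs t.length k
    rw [h, hid i t le_rfl]
  refine ⟨fun n => (s n).1.1 n, fun i t => (s t.length).1.2 i t,
    fun i => ⟨fun t => ?_, fun t c => ?_⟩, fun n t ht => ?_⟩
  · rw [((s t.length).2 i).1]
  · beta_reduce
    rw [← hagree i t (t ++ [c]).length (by simp)]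
    exact ((s _).2 i).2 t c
  · obtain ⟨κ₀, hκ₀⟩ := hhom n (s n) t ht
    refine ⟨κ₀, fun m g hg => ?_⟩
    have hm : n + 1 ≤ m := by
      obtain ⟨i⟩ := ‹Nonempty I›
      obtain ⟨c⟩ := ‹∀ i, Nonempty (B i)› i
      have := (hg i c).2.length_le
      rw [(hg i c).1, List.length_append, ht i] at this
      exact this
    obtain ⟨k, rfl⟩ := Nat.exists_eq_add_of_le hm
    obtain ⟨m', ρ, hρ, hid, h⟩ := hs (n + 1) k
    have hfan : FanAt t (m' (n + 1 + k)) (fun i c => ρ i (g i c)) := by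
      have := hg.emb hρ
      rwa [show (fun i => ρ i (t i)) = t from
        funext fun i => hid i _ ((ht i).le.trans (Nat.le_succ n))] at this
    rw [← hκ₀ _ _ hfan]
    congr 1
    · funext i
      beta_reduce
      rw [← hagree i (t i) (n + 1) ((ht i).le.trans (Nat.le_succ n))]
    · funext i c
      beta_reduce
      rw [(hg i c).1, h]

end Fusion

/-- `e` identifies the tree of words over `Fin b` with a homogeneous tree of sequences. -/
def TreeCode {b : ℕ} (e : List (Fin b) → List ℕ) : Prop :=
  (∃ l : ℕ → ℕ, ∀ t, (e t).length = l t.length) ∧ ∀ t (c : Fin b), e t ++ [(c : ℕ)] <+: e (t ++ [c])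

theorem eq_of_append_singleton_prefix {A : Type*} {s t : List A} {a a' : A} (h : s ++ [a] <+: t)
    (h' : s ++ [a'] <+: t) : a = a' := by
  have := List.prefix_of_prefix_length_le h h' (by simp)
  simpa using this.eq_of_length (by simp)

theorem exists_append_singleton_prefix {A : Type*} {s t : List A} (h : s <+: t) (hne : s ≠ t) :
    ∃ a, s ++ [a] <+: t := by
  obtain ⟨u, rfl⟩ := h
  cases u with
  | nil => simp at hne
  | cons a u => exact ⟨a, u, by simp⟩

theorem finite_strictPrefix (S : Set (List ℕ)) (t : List ℕ) :
    {s ∈ S | s <+: t ∧ s ≠ t}.Finite :=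
  (t.inits.toFinset.finite_toSet).subset fun s hs => by simpa using hs.2.1

namespace TreeCode

variable {b : ℕ} {e : List (Fin b) → List ℕ}

theorem mono (he : TreeCode e) {s t : List (Fin b)} (hst : s <+: t) : e s <+: e t := by
  obtain ⟨u, rfl⟩ := hst
  induction u using List.reverseRecOn with
  | nil => simp
  | append_singleton u c ih =>
    rw [← List.append_assoc]
    exact ih.trans ((List.prefix_append _ _).trans (he.2 _ _))

theorem append_singleton_prefix (he : TreeCode e) {s t : List (Fin b)} {c : Fin b}
    (hst : s ++ [c] <+: t) : e s ++ [(c : ℕ)] <+: e t :=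
  (he.2 s c).trans (he.mono hst)

theorem prefix_iff (he : TreeCode e) {s t : List (Fin b)} : e s <+: e t ↔ s <+: t := by
  refine ⟨fun h => ?_, he.mono⟩
  induction s using List.reverseRecOn with
  | nil => simp
  | append_singleton s c ih =>
    have hc : e s ++ [(c : ℕ)] <+: e t := (he.2 s c).trans h
    have hs := ih ((List.prefix_append _ _).trans hc)
    have hne : s ≠ t := by
      rintro rfl
      simpa using hc.length_le
    obtain ⟨c', hc'⟩ := exists_append_singleton_prefix hs hne
    have := eq_of_append_singleton_prefix hc (he.append_singleton_prefix hc')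
    rwa [Fin.val_injective this]

theorem injective (he : TreeCode e) : Function.Injective e := fun s t h => by
  have h1 : s <+: t := he.prefix_iff.1 (h ▸ List.prefix_refl _)
  have h2 : t <+: s := he.prefix_iff.1 (h ▸ List.prefix_refl _)
  exact h1.eq_of_length (le_antisymm h1.length_le h2.length_le)

theorem mem_level_iff (he : TreeCode e) {t : List (Fin b)} {n : ℕ} :
    e t ∈ level (Set.range e) n ↔ t.length = n := by
  have h : {s ∈ Set.range e | s <+: e t ∧ s ≠ e t} =
      (fun k => e (t.take k)) '' Set.Iio t.length := by
    ext s
    constructor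
    · rintro ⟨⟨s, rfl⟩, hst, hne⟩
      rw [he.prefix_iff] at hst
      refine ⟨s.length, lt_of_le_of_ne hst.length_le fun h => hne ?_, ?_⟩
      · rw [hst.eq_of_length h]
      · exact congrArg e (List.prefix_iff_eq_take.1 hst).symm
    · rintro ⟨k, hk, rfl⟩
      refine ⟨⟨_, rfl⟩, he.mono (List.take_prefix _ _), fun h => ?_⟩
      have := congrArg List.length (he.injective h)
      simp only [List.length_take, Set.mem_Iio] at this hk
      omega
  have hcard : {s ∈ Set.range e | s <+: e t ∧ s ≠ e t}.ncard = t.length := by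
    rw [h, Set.InjOn.ncard_image, ← Finset.coe_Iio, Set.ncard_coe_finset, Nat.card_Iio]
    intro k hk k' hk' hkk
    have := congrArg List.length (he.injective hkk)
    simp only [List.length_take, Set.mem_Iio] at this hk hk'
    omega
  constructor
  · rintro ⟨-, h⟩
    rw [← h, hcard]
  · rintro rfl
    exact ⟨⟨t, rfl⟩, hcard⟩

theorem level_range (he : TreeCode e) (n : ℕ) :
    level (Set.range e) n = e '' {t | t.length = n} := by
  ext x
  constructor
  · intro hx
    obtain ⟨t, rfl⟩ := hx.1
    exact ⟨t, he.mem_level_iff.1 hx, rfl⟩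
  · rintro ⟨t, ht, rfl⟩
    exact he.mem_level_iff.2 ht

theorem immSuc_iff (he : TreeCode e) {t : List (Fin b)} {x : List ℕ} :
    ImmSuc (Set.range e) (e t) x ↔ ∃ c, x = e (t ++ [c]) := by
  constructor
  · rintro ⟨-, ⟨s, rfl⟩, hts, hne, h⟩
    obtain ⟨c, hc⟩ := exists_append_singleton_prefix (he.prefix_iff.1 hts)
      fun h => hne (congrArg e h)
    refine ⟨c, ?_⟩
    rcases h (e (t ++ [c])) ⟨_, rfl⟩ (he.mono (List.prefix_append _ _)) (he.mono hc) with h | h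
    · simpa using he.injective h
    · exact h.symm
  · rintro ⟨c, rfl⟩
    refine ⟨⟨_, rfl⟩, ⟨_, rfl⟩, he.mono (List.prefix_append _ _), fun h => ?_, ?_⟩
    · simpa using he.injective h
    · rintro _ ⟨u, rfl⟩ htu hut
      rw [he.prefix_iff] at htu hut
      rcases Nat.lt_or_ge t.length u.length with h | h
      · right
        rw [hut.eq_of_length (le_antisymm hut.length_le (by simpa using h))]
      · left
        rw [htu.eq_of_length (le_antisymm htu.length_le h)]

theorem comp (he : TreeCode e) {l : ℕ → ℕ} {σ : List (Fin b) → List (Fin b)}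
    (hσ : TreeEmb l σ) : TreeCode fun t => e (σ t) := by
  obtain ⟨⟨m, hm⟩, -⟩ := id he
  exact ⟨⟨fun n => m (l n), fun t => by rw [hm, hσ.1]⟩,
    fun t c => he.append_singleton_prefix (hσ.2 t c)⟩

theorem shift (he : TreeCode e) (s : List (Fin b)) : TreeCode fun t => e (s ++ t) := by
  obtain ⟨⟨m, hm⟩, -⟩ := id he
  exact ⟨⟨fun n => m (s.length + n), fun t => by rw [hm, List.length_append]⟩,
    fun t c => he.append_singleton_prefix (by rw [List.append_assoc])⟩

theorem suc_range (he : TreeCode e) (s : List (Fin b)) :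
    suc (Set.range e) (e s) = Set.range fun t => e (s ++ t) := by
  ext x
  constructor
  · rintro ⟨⟨t, rfl⟩, hst⟩
    obtain ⟨u, rfl⟩ := he.prefix_iff.1 hst
    exact ⟨u, rfl⟩
  · rintro ⟨u, rfl⟩
    exact ⟨⟨_, rfl⟩, he.mono (List.prefix_append _ _)⟩

theorem map_val (b : ℕ) : TreeCode fun t : List (Fin b) => t.map Fin.val :=
  ⟨⟨fun n => n, fun t => List.length_map _⟩, fun t c => by simp⟩

theorem range_map_val (b : ℕ) : (Set.range fun t : List (Fin b) => t.map Fin.val) = bSeq b := by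
  ext x
  constructor
  · rintro ⟨t, rfl⟩ y hy
    obtain ⟨c, -, rfl⟩ := List.mem_map.1 hy
    exact c.2
  · intro (hx : ∀ y ∈ x, y < b)
    refine ⟨x.pmap (fun y hy => ⟨y, hy⟩) hx, ?_⟩
    simp [List.map_pmap]

/-- The image of a tree embedding is a strong subtree. -/
theorem isStrongSubtreeWith (he : TreeCode e) [NeZero b] {l : ℕ → ℕ}
    {σ : List (Fin b) → List (Fin b)} (hσ : TreeEmb l σ) :
    IsStrongSubtreeWith (Set.range e) (Set.range fun t => e (σ t)) l := by
  have he' := he.comp hσ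
  refine ⟨?_, ⟨e (σ []), he'.mem_level_iff.2 rfl, ?_⟩, hσ.strictMono, ?_, ?_⟩
  · rintro _ ⟨t, rfl⟩
    exact ⟨_, rfl⟩
  · intro x hx
    rw [he'.level_range] at hx
    obtain ⟨t, ht, rfl⟩ := hx
    rw [List.length_eq_zero_iff.1 ht]
  · intro n x hx
    rw [he'.level_range] at hx
    obtain ⟨t, ht, rfl⟩ := hx
    refine he.mem_level_iff.2 ?_
    rw [hσ.1, ht]
  · rintro _ ⟨t, rfl⟩ x hx
    obtain ⟨c, rfl⟩ := he.immSuc_iff.1 hx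
    refine ⟨e (σ (t ++ [c])), ⟨he'.immSuc_iff.2 ⟨c, rfl⟩, he.mono (hσ.2 t c)⟩, ?_⟩
    rintro y ⟨hy, hcy⟩
    obtain ⟨c', rfl⟩ := he'.immSuc_iff.1 hy
    rw [he.prefix_iff] at hcy
    rw [eq_of_append_singleton_prefix hcy (hσ.2 t c')]

end TreeCode

theorem ImmSuc.mem_level {S : Set (List ℕ)} {s s' : List ℕ} (h : ImmSuc S s s') {n : ℕ}
    (hs : s ∈ level S n) : s' ∈ level S (n + 1) := by
  refine ⟨h.2.1, ?_⟩
  have hset : {u ∈ S | u <+: s' ∧ u ≠ s'} = insert s {u ∈ S | u <+: s ∧ u ≠ s} := by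
    ext u
    constructor
    · rintro ⟨hu, hus, hne⟩
      rcases List.prefix_or_prefix_of_prefix hus h.2.2.1 with h1 | h1
      · by_cases hus' : u = s
        · exact Or.inl hus'
        · exact Or.inr ⟨hu, h1, hus'⟩
      · exact Or.inl ((h.2.2.2.2 u hu h1 hus).resolve_right hne)
    · rintro (rfl | ⟨hu, hus, hne⟩)
      · exact ⟨h.1, h.2.2.1, h.2.2.2.1⟩
      · refine ⟨hu, hus.trans h.2.2.1, ?_⟩
        rintro rfl
        exact hne (hus.eq_of_length (le_antisymm hus.length_le h.2.2.1.length_le))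
  rw [hset, Set.ncard_insert_of_notMem (fun h => h.2.2 rfl) (finite_strictPrefix S s), hs.2]

/-- Every strong subtree of a coded tree is the image of a tree embedding. -/
theorem TreeCode.exists_treeEmb {b : ℕ} {e : List (Fin b) → List ℕ} (he : TreeCode e)
    {S : Set (List ℕ)} {l : ℕ → ℕ} (hS : IsStrongSubtreeWith (Set.range e) S l) :
    ∃ σ : List (Fin b) → List (Fin b), TreeEmb l σ ∧ S = Set.range fun t => e (σ t) := by
  obtain ⟨hST, ⟨r, hr, hr'⟩, -, hlev, himm⟩ := hS
  obtain ⟨r₀, rfl⟩ := hST hr.1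
  have step : ∀ (x : {x // e x ∈ S}) (c : Fin b), ∃ y : {y // e y ∈ S},
      ImmSuc S (e x) (e y) ∧ e (x ++ [c]) <+: e y := by
    intro x c
    obtain ⟨s, ⟨h1, h2⟩, -⟩ := himm (e x) x.2 _ (he.immSuc_iff.2 ⟨c, rfl⟩)
    obtain ⟨y, rfl⟩ := hST h1.2.1
    exact ⟨⟨y, h1.2.1⟩, h1, h2⟩
  choose next hnext hnext' using step
  let σ : List (Fin b) → {x // e x ∈ S} := fun t => t.foldl next ⟨r₀, hr.1⟩
  have hσ : ∀ t c, σ (t ++ [c]) = next (σ t) c := fun t c => by simp [σ]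
  have hσlev : ∀ t, e (σ t) ∈ level S t.length := by
    intro t
    induction t using List.reverseRecOn with
    | nil => exact hr
    | append_singleton t c ih =>
      rw [hσ, List.length_append]
      exact (hnext _ _).mem_level ih
  refine ⟨fun t => (σ t).1, ⟨fun t => he.mem_level_iff.1 (hlev _ (hσlev t)), fun t c => ?_⟩, ?_⟩
  · beta_reduce
    rw [hσ]
    exact he.prefix_iff.1 (hnext' _ _)
  · refine Set.Subset.antisymm (fun x hx => ?_) (by rintro _ ⟨t, rfl⟩; exact (σ t).2)
    induction hn : x.length using Nat.strong_induction_on generalizing x with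
    | _ n ih =>
      rcases Set.eq_empty_or_nonempty {s ∈ S | s <+: x ∧ s ≠ x} with hemp | hne
      · refine ⟨[], (hr' x ⟨hx, ?_⟩).symm⟩
        rw [hemp, Set.ncard_empty]
      · obtain ⟨u, ⟨huS, hux, hune⟩, hmax⟩ := Set.exists_max_image _ List.length
          (finite_strictPrefix S x) hne
        have hlt : u.length < x.length :=
          lt_of_le_of_ne hux.length_le fun h => hune (hux.eq_of_length h)
        obtain ⟨t, rfl⟩ := ih u.length (hn ▸ hlt) u huS rfl
        beta_reduce at *
        obtain ⟨y, rfl⟩ := hST hx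
        obtain ⟨c, hc⟩ := exists_append_singleton_prefix (he.prefix_iff.1 hux)
          fun h => hune (congrArg e h)
        refine ⟨t ++ [c], ?_⟩
        beta_reduce
        rw [hσ]
        refine (himm _ huS _ (he.immSuc_iff.2 ⟨c, rfl⟩)).unique ⟨hnext _ _, hnext' _ _⟩
          ⟨⟨huS, hx, hux, hune, fun v hv huv hvx => ?_⟩, he.mono hc⟩
        by_cases hvx' : v = e y
        · exact Or.inr hvx'
        · exact Or.inl (huv.eq_of_length
            (le_antisymm huv.length_le (hmax v ⟨hv, hvx, hvx'⟩))).symm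

theorem IsHomogeneous.exists_treeCode {b : ℕ} {T : Set (List ℕ)} (hT : IsHomogeneous b T) :
    ∃ e : List (Fin b) → List ℕ, TreeCode e ∧ T = Set.range e := by
  obtain ⟨-, l, hl⟩ := hT
  rw [← TreeCode.range_map_val] at hl
  obtain ⟨σ, hσ, rfl⟩ := (TreeCode.map_val b).exists_treeEmb hl
  exact ⟨_, (TreeCode.map_val b).comp hσ, rfl⟩

theorem mem_vecLevel_range_iff {d : ℕ} {b : Fin d → ℕ} {e : ∀ i, List (Fin (b i)) → List ℕ}
    (he : ∀ i, TreeCode (e i)) {n : ℕ} {v : Fin d → List ℕ} :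
    v ∈ vecLevel (fun i => Set.range (e i)) n ↔ ∃ t, HasLength n t ∧ v = fun i => e i (t i) := by
  constructor
  · intro hv
    have : ∀ i, ∃ t : List (Fin (b i)), t.length = n ∧ e i t = v i := fun i => by
      have := hv i
      beta_reduce at this
      rwa [(he i).level_range] at this
    choose t ht htv using this
    exact ⟨t, ht, funext fun i => (htv i).symm⟩
  · rintro ⟨t, ht, rfl⟩ i
    exact (he i).mem_level_iff.2 (ht i)

theorem finite_hasLength {J : Type*} {B : J → Type*} [Finite J] [∀ j, Finite (B j)] (n : ℕ) :
    {t : ∀ j, List (B j) | HasLength n t}.Finite :=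
  Set.Finite.pi' fun j => List.finite_length_eq (B j) n

/-- A set of tuples of words which is dense on infinitely many levels contains a fan. -/
theorem exists_fan_of_frequently_dense {d : ℕ} [NeZero d] (hDHL : DHL d) {b : Fin d → ℕ}
    (hb : ∀ i, 2 ≤ b i) (A : Set (∀ i, List (Fin (b i)))) {δ : ℝ} (hδ : 0 < δ)
    (hA : ∃ᶠ n in atTop, δ * ({t : ∀ i, List (Fin (b i)) | HasLength n t}.ncard : ℝ) ≤
      ({t : ∀ i, List (Fin (b i)) | HasLength n t ∧ t ∈ A}.ncard : ℝ)) :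
    ∃ n m t g, HasLength n t ∧ n < m ∧ FanAt t m g ∧ t ∈ A ∧
      ∀ c : ∀ i, Fin (b i), (fun i => g i (c i)) ∈ A := by
  have hne : ∀ i, NeZero (b i) := fun i => ⟨by have := hb i; omega⟩
  let e : (∀ i, List (Fin (b i))) → Fin d → List ℕ := fun t i => (t i).map Fin.val
  have he : Function.Injective e := fun s t h => funext fun i =>
    (TreeCode.map_val (b i)).injective (congrFun h i)
  have hlev : ∀ n, vecLevel (fun i => bSeq (b i)) n = e '' {t | HasLength n t} := by
    intro n
    ext v
    have := mem_vecLevel_range_iff (fun i => TreeCode.map_val (b i)) (n := n) (v := v)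
    simp only [TreeCode.range_map_val] at this
    rw [this]
    exact ⟨fun ⟨t, ht, h⟩ => ⟨t, ht, h.symm⟩, fun ⟨t, ht, h⟩ => ⟨t, ht, h.symm⟩⟩
  let D : Set (Fin d → List ℕ) := e '' {t | t ∈ A ∧ ∃ n, HasLength n t}
  have hDlev : ∀ n, D ∩ vecLevel (fun i => bSeq (b i)) n = e '' {t | HasLength n t ∧ t ∈ A} := by
    intro n
    rw [hlev, ← Set.image_inter he]
    congr 1
    ext t
    exact ⟨fun h => ⟨h.2, h.1.1⟩, fun h => ⟨⟨h.2, n, h.1⟩, h.1⟩⟩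
  have hpos : ∀ n, 0 < ({t : ∀ i, List (Fin (b i)) | HasLength n t}.ncard : ℝ) := by
    intro n
    refine Nat.cast_pos.2 ((Set.ncard_pos (finite_hasLength n)).2 ?_)
    exact ⟨fun i => List.replicate n 0, fun i => List.length_replicate⟩
  obtain ⟨S, ⟨l, hS⟩, hSD⟩ := hDHL b (fun i => bSeq (b i))
    (fun i => ⟨hb i, fun n => n, by
      have := (TreeCode.map_val (b i)).isStrongSubtreeWith TreeEmb.id
      rwa [TreeCode.range_map_val] at this⟩) D
    (by
      rintro _ ⟨t, ⟨-, n, hn⟩, rfl⟩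
      refine Set.mem_iUnion.2 ⟨n, ?_⟩
      rw [hlev]
      exact ⟨t, hn, rfl⟩)
    (by
      refine hδ.trans_le (le_limsup_of_frequently_le ?_ ?_)
      · refine hA.mono fun n hn => ?_
        rwa [hDlev, hlev, Set.ncard_image_of_injective _ he, Set.ncard_image_of_injective _ he,
          le_div_iff₀ (hpos n)]
      · refine isBoundedUnder_of ⟨1, fun n => ?_⟩
        rw [hDlev, hlev, Set.ncard_image_of_injective _ he, Set.ncard_image_of_injective _ he]
        exact div_le_one_of_le₀ (Nat.cast_le.2 (Set.ncard_le_ncard (fun t ht => ht.1)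
          (finite_hasLength n))) (hpos n).le)
  have : ∀ i, ∃ σ : List (Fin (b i)) → List (Fin (b i)), TreeEmb l σ ∧
      S i = Set.range fun t => (σ t).map Fin.val := fun i => by
    have := hS i
    beta_reduce at this
    rw [← TreeCode.range_map_val] at this
    exact (TreeCode.map_val (b i)).exists_treeEmb this
  choose σ hσ hSσ using this
  have hmem : ∀ n t, HasLength n t → (fun i => σ i (t i)) ∈ A := by
    intro n t ht
    have : e (fun i => σ i (t i)) ∈ D := by
      refine hSD (Set.mem_iUnion.2 ⟨n, fun i => ?_⟩)
      rw [hSσ, ((TreeCode.map_val (b i)).comp (hσ i)).level_range]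
      exact ⟨t i, ht i, rfl⟩
    obtain ⟨s, hs, hst⟩ := this
    exact he hst ▸ hs.1
  exact ⟨l 0, l 1, fun i => σ i [], fun i c => σ i [c], fun i => (hσ i).1 _,
    (hσ 0).strictMono Nat.zero_lt_one, fun i c => ⟨(hσ i).1 _, (hσ i).2 [] c⟩,
    hmem 0 _ fun i => rfl, fun c => hmem 1 _ fun i => rfl⟩

section Measure

open MeasureTheory ENNReal

theorem exists_fan_measure_ne_zero {d : ℕ} [NeZero d] (hDHL : DHL d) {b : Fin d → ℕ}
    (hb : ∀ i, 2 ≤ b i) {ε : ℝ} (hε : 0 < ε) {Ω : Type*} [MeasurableSpace Ω] (μ : Measure Ω)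
    [IsProbabilityMeasure μ] (A : (∀ i, List (Fin (b i))) → Set Ω)
    (hAm : ∀ t, MeasurableSet (A t)) (hA : ∀ n t, HasLength n t → ε ≤ μ.real (A t)) :
    ∃ n m t g, HasLength n t ∧ n < m ∧ FanAt t m g ∧
      μ {x | x ∈ A t ∧ ∀ c : ∀ i, Fin (b i), x ∈ A fun i => g i (c i)} ≠ 0 := by
  classical
  by_contra! hnull
  have hae : ∀ᵐ x ∂μ, ∀ (n m : ℕ) (t : ∀ i, List (Fin (b i)))
      (g : ∀ i, Fin (b i) → List (Fin (b i))), HasLength n t → n < m → FanAt t m g →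
        ¬ (x ∈ A t ∧ ∀ c : ∀ i, Fin (b i), x ∈ A fun i => g i (c i)) := by
    simp only [ae_all_iff]
    intro n m t g ht hnm hg
    rw [ae_iff]
    simpa only [not_not] using hnull n m t g ht hnm hg
  let lev : ℕ → Finset (∀ i, List (Fin (b i))) := fun n => (finite_hasLength n).toFinset
  have hlev : ∀ n t, t ∈ lev n ↔ HasLength n t := fun n t => by simp [lev]
  have hcard : ∀ n, ((lev n).card : ℝ≥0∞) ≠ 0 := by
    intro n
    have hne : ∀ i, NeZero (b i) := fun i => ⟨by have := hb i; omega⟩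
    refine Nat.cast_ne_zero.2 (Finset.card_ne_zero.2 ⟨fun i => List.replicate n 0, ?_⟩)
    exact (hlev _ _).2 fun i => List.length_replicate
  let f : ℕ → Ω → ℝ≥0∞ := fun n x => (∑ t ∈ lev n, (A t).indicator 1 x) / (lev n).card
  have hf : ∀ n x, f n x = ((lev n).filter fun t => x ∈ A t).card / (lev n).card := by
    intro n x
    simp [f, Set.indicator_apply, Finset.sum_boole]
  have hfm : ∀ n, Measurable (f n) := fun n =>
    (Finset.measurable_fun_sum _ fun t _ => measurable_one.indicator (hAm t)).div_const _
  have hlim : ∀ᵐ x ∂μ, limsup (fun n => f n x) atTop = 0 := by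
    filter_upwards [hae] with x hx
    by_contra hne
    obtain ⟨δ, hδ0, hδ⟩ := exists_between (pos_iff_ne_zero.2 hne)
    have hfreq := frequently_lt_of_lt_limsup (by isBoundedDefault) hδ
    have hδtop : δ ≠ ∞ := hδ.ne_top
    obtain ⟨n, m, t, g, ht, hnm, hg, h⟩ := exists_fan_of_frequently_dense hDHL hb
      {t | x ∈ A t} (δ := δ.toReal) (toReal_pos hδ0.ne' hδtop) (hfreq.mono fun n hn => by
        rw [hf, ENNReal.lt_div_iff_mul_lt (Or.inl (hcard n)) (Or.inl (natCast_ne_top _))] at hn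
        have h1 : {t : ∀ i, List (Fin (b i)) | HasLength n t} = lev n := by
          ext t; simp [hlev]
        have h2 : {t : ∀ i, List (Fin (b i)) | HasLength n t ∧ t ∈ {t | x ∈ A t}} =
            (lev n).filter fun t => x ∈ A t := by
          ext t; simp [hlev]
        rw [h1, h2, Set.ncard_coe_finset, Set.ncard_coe_finset]
        simpa using ENNReal.toReal_mono (natCast_ne_top _) hn.le)
    exact hx n m t g ht hnm hg h
  have hintegral : ∀ n, ENNReal.ofReal ε ≤ ∫⁻ x, f n x ∂μ := by
    intro n
    have h1 : ∫⁻ x, f n x ∂μ = (∑ t ∈ lev n, μ (A t)) / (lev n).card := by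
      simp only [f, div_eq_mul_inv]
      rw [lintegral_mul_const, lintegral_finsetSum]
      · simp only [lintegral_indicator_one (hAm _)]
      · exact fun t _ => measurable_one.indicator (hAm t)
      · exact Finset.measurable_fun_sum _ fun t _ => measurable_one.indicator (hAm t)
    rw [h1, ENNReal.le_div_iff_mul_le (Or.inl (hcard n)) (Or.inl (natCast_ne_top _)), mul_comm,
      ← nsmul_eq_mul, ← Finset.sum_const]
    refine Finset.sum_le_sum fun t ht => ?_
    rw [← ofReal_measureReal]
    exact ofReal_le_ofReal (hA n t ((hlev n t).1 ht))
  have hle := limsup_lintegral_le (μ := μ) (f := f) 1 hfm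
    (fun n => Eventually.of_forall fun x => by
      rw [hf]
      refine ENNReal.div_le_of_le_mul ?_
      rw [Pi.one_apply, one_mul]
      exact_mod_cast Finset.card_filter_le _ _) (by simp)
  rw [lintegral_congr_ae hlim, lintegral_zero] at hle
  have : ENNReal.ofReal ε ≤ 0 :=
    le_trans (le_limsup_of_frequently_le (Frequently.of_forall hintegral) (by isBoundedDefault)) hle
  exact hε.not_ge (by simpa using this)

/-- Uniform version of `exists_fan_measure_ne_zero`. -/
theorem exists_uniform_fan {d : ℕ} [NeZero d] (hDHL : DHL d) {b : Fin d → ℕ}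
    (hb : ∀ i, 2 ≤ b i) {ε : ℝ} (hε : 0 < ε) :
    ∃ (N : ℕ) (θ : ℝ), 0 < θ ∧ ∀ (Ω : Type) [MeasurableSpace Ω] (μ : Measure Ω)
      [IsProbabilityMeasure μ] (A : (∀ i, List (Fin (b i))) → Set Ω), (∀ t, MeasurableSet (A t)) →
      (∀ n < N, ∀ t, HasLength n t → ε ≤ μ.real (A t)) →
      ∃ n m t g, HasLength n t ∧ n < m ∧ m < N ∧ FanAt t m g ∧
        θ ≤ μ.real {x | x ∈ A t ∧ ∀ c : ∀ i, Fin (b i), x ∈ A fun i => g i (c i)} := by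
  classical
  by_contra! hcon
  let X := (∀ i, List (Fin (b i))) → Bool
  let C : (∀ i, List (Fin (b i))) → Set X := fun t => {x | x t = true}
  have hC : ∀ t, IsClopen (C t) := fun t =>
    (isClopen_discrete {true}).preimage (continuous_apply t)
  have hfan : ∀ t (g : ∀ i, Fin (b i) → List (Fin (b i))),
      IsClopen {x | x ∈ C t ∧ ∀ c : ∀ i, Fin (b i), x ∈ C fun i => g i (c i)} := by
    intro t g
    have : {x | x ∈ C t ∧ ∀ c : ∀ i, Fin (b i), x ∈ C fun i => g i (c i)} =
        C t ∩ ⋂ c : ∀ i, Fin (b i), C fun i => g i (c i) := by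
      ext x; simp
    rw [this]
    exact (hC t).inter (isClopen_iInter_of_finite fun c => hC _)
  have hex : ∀ k : ℕ, ∃ ν : ProbabilityMeasure X,
      (∀ n < k, ∀ t, HasLength n t → ε ≤ ν (C t)) ∧
      ∀ n m t g, HasLength n t → n < m → m < k → FanAt t m g →
        (ν {x | x ∈ C t ∧ ∀ c : ∀ i, Fin (b i), x ∈ C fun i => g i (c i)} : ℝ) ≤
          1 / ((k : ℝ) + 1) := by
    intro k
    obtain ⟨Ω, _, μ, _, A, hAm, hA, hfan'⟩ := hcon k (1 / ((k : ℝ) + 1)) (by positivity)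
    let φ : Ω → X := fun x t => decide (x ∈ A t)
    have hφ : Measurable φ := measurable_pi_lambda _ fun t =>
      measurable_to_bool (by
        have : (fun x => φ x t) ⁻¹' {true} = A t := by ext x; simp [φ]
        rw [this]
        exact hAm t)
    let ν : ProbabilityMeasure X := ⟨μ.map φ, Measure.isProbabilityMeasure_map hφ.aemeasurable⟩
    have hν : ∀ s, MeasurableSet s → (ν s : ℝ) = μ.real (φ ⁻¹' s) := by
      intro s hs
      exact map_measureReal_apply hφ hs
    refine ⟨ν, fun n hn t ht => ?_, fun n m t g ht hnm hm hg => ?_⟩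
    · rw [hν _ (hC t).isOpen.measurableSet]
      have : φ ⁻¹' C t = A t := by ext x; simp [φ, C]
      rw [this]
      exact hA n hn t ht
    · rw [hν _ (hfan t g).isOpen.measurableSet]
      have : φ ⁻¹' {x | x ∈ C t ∧ ∀ c : ∀ i, Fin (b i), x ∈ C fun i => g i (c i)} =
          {x | x ∈ A t ∧ ∀ c : ∀ i, Fin (b i), x ∈ A fun i => g i (c i)} := by
        ext x
        simp [φ, C]
      rw [this]
      exact (hfan' n m t g ht hnm hm hg).le
  choose ν hν hν' using hex
  obtain ⟨ν₀, k, hk, hlim⟩ := CompactSpace.tendsto_subseq ν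
  have htends : ∀ s : Set X, IsClopen s →
      Tendsto (fun j => (ν (k j) s : ℝ)) atTop (nhds (ν₀ s : ℝ)) := fun s hs =>
    NNReal.tendsto_coe.2 (ProbabilityMeasure.tendsto_measure_of_isClopen_of_tendsto hlim hs)
  obtain ⟨n, m, t, g, ht, hnm, hg, hpos⟩ := exists_fan_measure_ne_zero hDHL hb hε
    (ν₀ : Measure X) C (fun t => (hC t).isOpen.measurableSet) fun n t ht => by
      refine ge_of_tendsto (htends _ (hC t)) ?_
      filter_upwards [hk.tendsto_atTop.eventually_gt_atTop n] with j hj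
      exact hν _ n hj t ht
  have hzero : (ν₀ {x | x ∈ C t ∧ ∀ c : ∀ i, Fin (b i), x ∈ C fun i => g i (c i)} : ℝ) ≤ 0 := by
    refine le_of_tendsto_of_tendsto (htends _ (hfan t g))
      (tendsto_one_div_add_atTop_nhds_zero_nat.comp hk.tendsto_atTop) ?_
    filter_upwards [hk.tendsto_atTop.eventually_gt_atTop m] with j hj
    exact hν' _ n m t g ht hnm hj hg
  exact hpos ((measureReal_eq_zero_iff).1 (le_antisymm hzero measureReal_nonneg))

end Measure

theorem ncard_length_eq (K : Type*) [Fintype K] (n : ℕ) :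
    {x : List K | x.length = n}.ncard = Fintype.card K ^ n := by
  rw [← card_vector, ← Nat.card_eq_fintype_card]
  rfl

theorem ncard_length_eq_prefix_mem {K : Type*} [Fintype K] {F : Set (List K)} {n M : ℕ}
    (hF : ∀ y ∈ F, y.length = n) (hnM : n ≤ M) :
    {x : List K | x.length = M ∧ ∃ y ∈ F, y <+: x}.ncard = F.ncard * Fintype.card K ^ (M - n) := by
  have : {x : List K | x.length = M ∧ ∃ y ∈ F, y <+: x} =
      (fun p : List K × List K => p.1 ++ p.2) '' (F ×ˢ {z | z.length = M - n}) := by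
    ext x
    constructor
    · rintro ⟨hx, y, hy, z, rfl⟩
      refine ⟨(y, z), ⟨hy, ?_⟩, rfl⟩
      have := hF y hy
      simp only [List.length_append, Set.mem_ofPred_eq] at hx ⊢
      omega
    · rintro ⟨⟨y, z⟩, ⟨hy, hz⟩, rfl⟩
      refine ⟨?_, y, hy, List.prefix_append _ _⟩
      have := hF y hy
      simp only [List.length_append, Set.mem_ofPred_eq] at hz ⊢
      omega
  rw [this, Set.InjOn.ncard_image, Set.ncard_prod, ncard_length_eq]
  rintro ⟨y, z⟩ ⟨hy, -⟩ ⟨y', z'⟩ ⟨hy', -⟩ h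
  exact Prod.ext_iff.2 (List.append_inj h ((hF y hy).trans (hF y' hy').symm))

theorem uniformOn_real_apply {Ω : Type*} [MeasurableSpace Ω] [MeasurableSingletonClass Ω]
    {s : Set Ω} (hs : s.Finite) (t : Set Ω) :
    (ProbabilityTheory.uniformOn s).real t = ((s ∩ t).ncard : ℝ) / (s.ncard : ℝ) := by
  have h1 := MeasureTheory.Measure.count_apply_finite s hs
  have h2 := MeasureTheory.Measure.count_apply_finite _ (hs.inter_of_left t)
  rw [MeasureTheory.measureReal_def, ProbabilityTheory.uniformOn,
    ProbabilityTheory.cond_apply hs.measurableSet, h1, h2, Set.ncard_eq_toFinset_card _ hs,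
    Set.ncard_eq_toFinset_card _ (hs.inter_of_left t)]
  simp [div_eq_inv_mul]

/-- The set `F` of words of length `n` has relative density at least `θ` above the word `u`. -/
def RelDense {K : Type*} [Fintype K] (θ : ℝ) (n : ℕ) (F : Set (List K)) (u : List K) : Prop :=
  θ * (Fintype.card K : ℝ) ^ (n - u.length) ≤ ({y ∈ F | u <+: y}.ncard : ℝ)

/-- `E` assigns to every tuple of words of length `n` a set of words of length `L n` of density at
least `ε`. -/
def DenseSel {I : Type*} {B : I → Type*} {K : Type*} [Fintype K] (ε : ℝ) (L : ℕ → ℕ)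
    (E : (∀ i, List (B i)) → Set (List K)) : Prop :=
  ∀ n t, HasLength n t → (∀ y ∈ E t, y.length = L n) ∧
    ε * (Fintype.card K : ℝ) ^ L n ≤ ((E t).ncard : ℝ)

theorem DenseSel.comp {I : Type*} {B : I → Type*} {K : Type*} [Fintype K] {ε : ℝ} {L : ℕ → ℕ}
    {E : (∀ i, List (B i)) → Set (List K)} (hE : DenseSel ε L E) {l : ℕ → ℕ}
    {σ : ∀ i, List (B i) → List (B i)} (hσ : ∀ i, TreeEmb l (σ i)) :
    DenseSel ε (fun n => L (l n)) fun t => E fun i => σ i (t i) :=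
  fun n _ ht => hE (l n) _ (ht.emb hσ)

/-- However a letter `P t w` is appended to each `w ∈ E t`, some fan is correlated above one of the
resulting words. -/
theorem exists_relDense_fan {d : ℕ} [NeZero d] (hDHL : DHL d) {b : Fin d → ℕ}
    (hb : ∀ i, 2 ≤ b i) {K : Type} [Fintype K] [Nontrivial K] {ε : ℝ} (hε : 0 < ε) :
    ∃ θ : ℝ, 0 < θ ∧ ∀ (L : ℕ → ℕ) (E : (∀ i, List (Fin (b i))) → Set (List K)),
      StrictMono L → DenseSel ε L E → ∀ P : (∀ i, List (Fin (b i))) → List K → K,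
      ∃ n m t g, HasLength n t ∧ FanAt t m g ∧ ∃ w ∈ E t,
        RelDense θ (L m) (⋂ c : ∀ i, Fin (b i), E fun i => g i (c i)) (w ++ [P t w]) := by
  classical
  have hq2 : 1 < Fintype.card K := Fintype.one_lt_card
  have hq : 0 < (Fintype.card K : ℝ) := by exact_mod_cast (by omega : 0 < Fintype.card K)
  obtain ⟨N, θ, hθ, hN⟩ := exists_uniform_fan hDHL hb (div_pos hε hq)
  refine ⟨θ, hθ, fun L E hL hE P => ?_⟩
  let _ : MeasurableSpace (List K) := ⊤
  have : MeasurableSingletonClass (List K) := ⟨fun _ => trivial⟩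
  have hfin : {x : List K | x.length = L N + 1}.Finite := List.finite_length_eq K _
  have := ProbabilityTheory.isProbabilityMeasure_uniformOn hfin
    ⟨List.replicate _ (Classical.arbitrary K), List.length_replicate⟩
  obtain ⟨n, m, t, g, ht, hnm, hm, hg, h⟩ := hN (List K)
    (ProbabilityTheory.uniformOn {x : List K | x.length = L N + 1})
    (fun t => {x | ∃ y ∈ (fun w => w ++ [P t w]) '' E t, y <+: x}) (fun t => trivial)
    (fun n hn t ht => by
      obtain ⟨hlen, hcard⟩ := hE n t ht
      rw [uniformOn_real_apply hfin, ncard_length_eq]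
      have h1 := ncard_length_eq_prefix_mem (F := (fun w => w ++ [P t w]) '' E t) (n := L n + 1)
        (M := L N + 1) (by rintro _ ⟨w, hw, rfl⟩; simp [hlen w hw]) (by have := hL hn; omega)
      rw [Set.InjOn.ncard_image fun w hw w' hw' h => List.append_inj_left h
        ((hlen w hw).trans (hlen w' hw').symm)] at h1
      rw [Set.inter_def]
      simp only [Set.mem_ofPred_eq]
      rw [h1, div_le_div_iff₀ hq (by positivity)]
      obtain ⟨k, hk⟩ := Nat.exists_eq_add_of_le (hL hn).le
      calc ε * ((Fintype.card K ^ (L N + 1) : ℕ) : ℝ)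
          = ε * (Fintype.card K : ℝ) ^ L n * (Fintype.card K : ℝ) ^ (L N + 1 - (L n + 1)) *
              Fintype.card K := by
            rw [hk, show L n + k + 1 - (L n + 1) = k by omega]
            push_cast
            ring
        _ ≤ _ := by
            push_cast
            gcongr)
  refine ⟨n, m, t, g, ht, hg, ?_⟩
  by_contra! hcon
  have hLnm : L n < L m := hL hnm
  have hLmN : L m < L N := hL hm
  have hne : ∀ i, NeZero (b i) := fun i => ⟨by have := hb i; omega⟩
  have hgc : ∀ c : ∀ i, Fin (b i), HasLength m fun i => g i (c i) := fun c i => (hg i (c i)).1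
  have hEfin : (E t).Finite := (List.finite_length_eq K (L n)).subset (hE n t ht).1
  let F : List K → Set (List K) := fun w =>
    {y ∈ ⋂ c : ∀ i, Fin (b i), E fun i => g i (c i) | w ++ [P t w] <+: y}
  have hF : ∀ w, ∀ y ∈ F w, y.length = L m := fun w y hy =>
    (hE m _ (hgc 0)).1 y (Set.mem_iInter.1 hy.1 0)
  have hsub : {x : List K | x.length = L N + 1} ∩
      {x | x ∈ {x | ∃ y ∈ (fun w => w ++ [P t w]) '' E t, y <+: x} ∧ ∀ c : ∀ i, Fin (b i),
        x ∈ {x | ∃ y ∈ (fun w => w ++ [P (fun i => g i (c i)) w]) '' E fun i => g i (c i),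
          y <+: x}} ⊆
      ⋃ w ∈ hEfin.toFinset, {x | x.length = L N + 1 ∧ ∃ y ∈ F w, y <+: x} := by
    rintro x ⟨hx, ⟨_, ⟨w, hw, rfl⟩, hwx⟩, hxc⟩
    refine Set.mem_iUnion₂.2 ⟨w, by simpa using hw, hx, x.take (L m), ⟨?_, ?_⟩,
      List.take_prefix _ _⟩
    · refine Set.mem_iInter.2 fun c => ?_
      obtain ⟨_, ⟨v, hv, rfl⟩, hvx⟩ := hxc c
      rw [← (hE m _ (hgc c)).1 v hv,
        ← List.prefix_iff_eq_take.1 ((List.prefix_append _ _).trans hvx)]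
      exact hv
    · refine List.prefix_of_prefix_length_le hwx (List.take_prefix _ _) ?_
      rw [List.length_take, List.length_append, (hE n t ht).1 w hw, hx]
      simp
      omega
  have hbound : ∀ w ∈ hEfin.toFinset,
      ({x : List K | x.length = L N + 1 ∧ ∃ y ∈ F w, y <+: x}.ncard : ℝ) ≤
        θ * (Fintype.card K : ℝ) ^ (L N - L n) := by
    intro w hw
    have hw' : w ∈ E t := by simpa using hw
    have h1 := (not_le.1 (hcon w hw')).le
    rw [List.length_append, (hE n t ht).1 w hw'] at h1
    rw [ncard_length_eq_prefix_mem (hF w) (by omega),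
      show L N - L n = L m - (L n + [P t w].length) + (L N + 1 - L m) by simp; omega, pow_add,
      ← mul_assoc]
    push_cast
    gcongr
  have hcardE : ((E t).ncard : ℝ) ≤ (Fintype.card K : ℝ) ^ L n := by
    rw [← Nat.cast_pow, ← ncard_length_eq]
    exact Nat.cast_le.2 (Set.ncard_le_ncard (hE n t ht).1 (List.finite_length_eq K (L n)))
  rw [uniformOn_real_apply hfin, ncard_length_eq, le_div_iff₀ (by positivity)] at h
  have hfinU : (⋃ w ∈ hEfin.toFinset,
      {x : List K | x.length = L N + 1 ∧ ∃ y ∈ F w, y <+: x}).Finite :=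
    hfin.subset (Set.iUnion₂_subset fun w _ x hx => hx.1)
  have htotal := calc
    θ * ((Fintype.card K ^ (L N + 1) : ℕ) : ℝ)
      ≤ ((⋃ w ∈ hEfin.toFinset,
          {x : List K | x.length = L N + 1 ∧ ∃ y ∈ F w, y <+: x}).ncard : ℝ) :=
        h.trans (Nat.cast_le.2 (Set.ncard_le_ncard hsub hfinU))
    _ ≤ ∑ w ∈ hEfin.toFinset,
          ({x : List K | x.length = L N + 1 ∧ ∃ y ∈ F w, y <+: x}.ncard : ℝ) := by
        exact_mod_cast Finset.set_ncard_biUnion_le _ _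
    _ ≤ (E t).ncard * (θ * (Fintype.card K : ℝ) ^ (L N - L n)) := by
        rw [Set.ncard_eq_toFinset_card _ hEfin, ← nsmul_eq_mul]
        exact Finset.sum_le_card_nsmul _ _ _ hbound
    _ ≤ (Fintype.card K : ℝ) ^ L n * (θ * (Fintype.card K : ℝ) ^ (L N - L n)) := by gcongr
    _ = θ * (Fintype.card K : ℝ) ^ L N := by
        rw [mul_left_comm, ← pow_add, Nat.add_sub_cancel' (by omega)]
  have hlt : (Fintype.card K : ℝ) ^ L N < (Fintype.card K : ℝ) ^ (L N + 1) :=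
    pow_lt_pow_right₀ (by exact_mod_cast hq2) (Nat.lt_succ_self _)
  push_cast at htotal
  exact absurd (le_of_mul_le_mul_left htotal hθ) (not_le.2 hlt)

theorem RelDense.mono {K : Type*} [Fintype K] {θ θ' : ℝ} {n : ℕ} {F : Set (List K)} {u : List K}
    (h : RelDense θ n F u) (hθ : θ' ≤ θ) : RelDense θ' n F u :=
  le_trans (by gcongr) h

/-- A dense selection of words is correlated everywhere on a suitable vector subtree. -/
theorem exists_treeEmb_relDense {d : ℕ} [NeZero d] (hDHL : DHL d) {b : Fin d → ℕ}
    (hb : ∀ i, 2 ≤ b i) {K : Type} [Fintype K] [Nontrivial K] {ε : ℝ} (hε : 0 < ε) {L : ℕ → ℕ}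
    (hL : StrictMono L) {E : (∀ i, List (Fin (b i))) → Set (List K)} (hE : DenseSel ε L E) :
    ∃ (l : ℕ → ℕ) (σ : ∀ i, List (Fin (b i)) → List (Fin (b i))) (θ : ℝ),
      (∀ i, TreeEmb l (σ i)) ∧ 0 < θ ∧ θ ≤ 1 ∧ ∀ n t, HasLength n t →
        ∃ w ∈ E fun i => σ i (t i), ∀ m g, FanAt t m g → ∀ p : K,
          RelDense θ (L (l m)) (⋂ c : ∀ i, Fin (b i), E fun i => σ i (g i (c i))) (w ++ [p]) := by
  classical
  have hne : ∀ i, NeZero (b i) := fun i => ⟨by have := hb i; omega⟩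
  obtain ⟨θ, hθ, hfan⟩ := exists_relDense_fan hDHL hb (K := K) hε
  let χ : (∀ i, List (Fin (b i))) → (∀ i, Fin (b i) → List (Fin (b i))) → Set (List K × K) :=
    fun s g => {x | x.1 ∈ E s ∧
      RelDense θ (L (g 0 0).length) (⋂ c : ∀ i, Fin (b i), E fun i => g i (c i)) (x.1 ++ [x.2])}
  have hχ : ∀ n t, HasLength n t → (Set.range (χ t)).Finite := by
    intro n t ht
    have hfin : (E t).Finite := (List.finite_length_eq K (L n)).subset (hE n t ht).1
    refine (hfin.prod (Set.finite_univ (α := K))).finite_subsets.subset ?_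
    rintro _ ⟨g, rfl⟩ x hx
    exact ⟨hx.1, trivial⟩
  obtain ⟨l₁, σ, hσ, hhom⟩ := exists_treeEmb_fan_homogeneous χ hχ
  obtain ⟨l₂, ρ, hρ, good, hgood⟩ := exists_monochromatic_treeEmb (fun t =>
    ∃ w ∈ E fun i => σ i (t i), ∀ m g, FanAt t m g → ∀ p : K,
      RelDense θ (L (l₁ m)) (⋂ c : ∀ i, Fin (b i), E fun i => σ i (g i (c i))) (w ++ [p]))
    Set.univ Set.finite_univ fun _ _ _ => trivial
  have hσρ : ∀ i, TreeEmb (fun n => l₁ (l₂ n)) fun t => σ i (ρ i t) := fun i =>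
    (hσ i).comp (hρ i)
  refine ⟨fun n => l₁ (l₂ n), fun i t => σ i (ρ i t), min θ 1, hσρ, lt_min hθ one_pos,
    min_le_right _ _, ?_⟩
  by_cases htrue : good
  · intro n t ht
    obtain ⟨w, hw, h⟩ := (hgood n t ht).mpr htrue
    exact ⟨w, hw, fun m g hg p => (h _ _ (hg.emb hρ) p).mono (min_le_left _ _)⟩
  · exfalso
    have hbad : ∀ n t, HasLength n t → ∀ w ∈ E fun i => σ i (ρ i (t i)), ∃ p : K, ∀ m g,
        FanAt t m g → ¬ RelDense θ (L (l₁ (l₂ m)))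
          (⋂ c : ∀ i, Fin (b i), E fun i => σ i (ρ i (g i (c i)))) (w ++ [p]) := by
      intro n t ht w hw
      have := (iff_of_eq (hgood n t ht)).not.mpr htrue
      push Not at this
      obtain ⟨m', g', hg', p, hp⟩ := this w hw
      refine ⟨p, fun m g hg hdense => hp ?_⟩
      obtain ⟨κ₀, hκ₀⟩ := hhom _ _ (ht.emb hρ)
      have hmem : (w, p) ∈ χ (fun i => σ i (ρ i (t i))) (fun i c => σ i (ρ i (g i c))) := by
        refine ⟨hw, ?_⟩
        rwa [(hσ _).1, (hρ _).1, (hg _ _).1]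
      rw [hκ₀ _ _ (hg.emb hρ), ← hκ₀ _ _ hg'] at hmem
      have := hmem.2
      rwa [(hσ _).1, (hg' _ _).1] at this
    have : ∀ t w, ∃ p : K, (∃ n, HasLength n t) → (w ∈ E fun i => σ i (ρ i (t i))) → ∀ m g,
        FanAt t m g → ¬ RelDense θ (L (l₁ (l₂ m)))
          (⋂ c : ∀ i, Fin (b i), E fun i => σ i (ρ i (g i (c i)))) (w ++ [p]) := by
      intro t w
      by_cases h : (∃ n, HasLength n t) ∧ w ∈ E fun i => σ i (ρ i (t i))
      · obtain ⟨p, hp⟩ := hbad _ t h.1.choose_spec w h.2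
        exact ⟨p, fun _ _ => hp⟩
      · exact ⟨Classical.arbitrary K, fun h1 h2 => absurd ⟨h1, h2⟩ h⟩
    choose P hP using this
    obtain ⟨n, m, t, g, ht, hg, w, hw, h⟩ := hfan (fun n => L (l₁ (l₂ n)))
      (fun t => E fun i => σ i (ρ i (t i))) (hL.comp (hσρ 0).strictMono) (hE.comp hσρ) P
    exact hP t w ⟨n, ht⟩ hw m g hg h

namespace TreeCode

variable {b : ℕ} {e : List (Fin b) → List ℕ}

theorem mem_level_zero_fan (he : TreeCode e) :
    e [] ∈ level (level (Set.range e) 0 ∪ level (Set.range e) 1) 0 := by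
  refine ⟨Or.inl (he.mem_level_iff.2 rfl), ?_⟩
  have : {s ∈ level (Set.range e) 0 ∪ level (Set.range e) 1 | s <+: e [] ∧ s ≠ e []} = ∅ := by
    refine Set.eq_empty_of_forall_notMem fun x hx => ?_
    obtain ⟨hx, hxe, hne⟩ := hx
    obtain ⟨t, rfl⟩ := hx.elim (fun h => h.1) fun h => h.1
    rw [he.prefix_iff, List.prefix_nil] at hxe
    exact hne (congrArg e hxe)
  rw [this, Set.ncard_empty]

theorem mem_level_one_fan_iff (he : TreeCode e) {x : List ℕ} :
    x ∈ level (level (Set.range e) 0 ∪ level (Set.range e) 1) 1 ↔ ∃ c, x = e [c] := by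
  constructor
  · intro hx
    rcases hx.1 with h | h
    · rw [he.level_range] at h
      obtain ⟨t, ht, rfl⟩ := h
      rw [List.length_eq_zero_iff.1 ht] at hx
      exact absurd (hx.2.symm.trans he.mem_level_zero_fan.2) one_ne_zero
    · rw [he.level_range] at h
      obtain ⟨t, ht, rfl⟩ := h
      obtain ⟨c, rfl⟩ := List.length_eq_one_iff.1 ht
      exact ⟨c, rfl⟩
  · rintro ⟨c, rfl⟩
    refine ⟨Or.inr (he.mem_level_iff.2 rfl), ?_⟩
    have : {s ∈ level (Set.range e) 0 ∪ level (Set.range e) 1 | s <+: e [c] ∧ s ≠ e [c]} =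
        {e []} := by
      ext x
      constructor
      · rintro ⟨hx, hxe, hne⟩
        obtain ⟨t, rfl⟩ := hx.elim (fun h => h.1) fun h => h.1
        rw [he.prefix_iff] at hxe
        rcases Nat.lt_or_ge t.length 1 with h | h
        · rw [List.length_eq_zero_iff.1 (Nat.lt_one_iff.1 h)]
          rfl
        · exact absurd (congrArg e (hxe.eq_of_length (le_antisymm hxe.length_le h))) hne
      · rintro rfl
        refine ⟨Or.inl (he.mem_level_iff.2 rfl), he.mono (List.nil_prefix), fun h => ?_⟩
        simpa using he.injective h
    rw [this, Set.ncard_singleton]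

theorem ncard_level (he : TreeCode e) (n : ℕ) : (level (Set.range e) n).ncard = b ^ n := by
  rw [he.level_range, Set.ncard_image_of_injective _ he.injective, ncard_length_eq,
    Fintype.card_fin]

theorem ncard_level_inter_suc (he : TreeCode e) {u : List (Fin b)} {n : ℕ} (hu : u.length ≤ n) :
    (level (Set.range e) n ∩ suc (Set.range e) (e u)).ncard = b ^ (n - u.length) := by
  have : level (Set.range e) n ∩ suc (Set.range e) (e u) =
      e '' {x | x.length = n ∧ ∃ y ∈ ({u} : Set (List (Fin b))), y <+: x} := by
    ext x
    constructor
    · rintro ⟨hx, ⟨t, rfl⟩, ht⟩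
      exact ⟨t, ⟨he.mem_level_iff.1 hx, u, rfl, he.prefix_iff.1 ht⟩, rfl⟩
    · rintro ⟨t, ⟨ht, _, rfl, hut⟩, rfl⟩
      exact ⟨he.mem_level_iff.2 ht, ⟨t, rfl⟩, he.mono hut⟩
  rw [this, Set.ncard_image_of_injective _ he.injective,
    ncard_length_eq_prefix_mem (by simp) hu, Set.ncard_singleton, one_mul, Fintype.card_fin]

/-- Relative density in a coded tree is computed on the words. -/
theorem le_densRel (he : TreeCode e) [NeZero b] {θ : ℝ} {n : ℕ} {F : Set (List ℕ)}
    {u : List (Fin b)} (hu : u.length ≤ n) (h : RelDense θ n (e ⁻¹' F) u) :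
    θ ≤ densRel (Set.range e) n F (e u) := by
  have hF : F ∩ suc (Set.range e) (e u) = e '' {y ∈ e ⁻¹' F | u <+: y} := by
    ext x
    constructor
    · rintro ⟨hx, ⟨t, rfl⟩, ht⟩
      exact ⟨t, ⟨hx, he.prefix_iff.1 ht⟩, rfl⟩
    · rintro ⟨t, ⟨ht, hut⟩, rfl⟩
      exact ⟨ht, ⟨t, rfl⟩, he.mono hut⟩
  have hb : (0 : ℝ) < b := Nat.cast_pos.2 (NeZero.pos b)
  rw [densRel, hF, he.ncard_level_inter_suc hu, Set.ncard_image_of_injective _ he.injective,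
    Nat.cast_pow, le_div_iff₀ (by positivity)]
  simpa [RelDense] using h

theorem eq_of_isConcat (he : TreeCode e) {w : List (Fin b)} {p : Fin b} {s : List ℕ}
    (h : IsConcat (Set.range e) (e w) p s) : s = e (w ++ [p]) := by
  obtain ⟨hs, hps⟩ := h
  obtain ⟨c, rfl⟩ := he.immSuc_iff.1 hs
  rw [Fin.val_injective (eq_of_append_singleton_prefix hps (he.2 w c))]

end TreeCode

theorem IsDenseLevelSel.denseSel {d : ℕ} {b : Fin d → ℕ} {e : ∀ i, List (Fin (b i)) → List ℕ}
    (he : ∀ i, TreeCode (e i)) {bW : ℕ} [NeZero bW] {eW : List (Fin bW) → List ℕ}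
    (heW : TreeCode eW) {l : ℕ → ℕ} {ε : ℝ} {D : (Fin d → List ℕ) → Set (List ℕ)}
    (hD : IsDenseLevelSel (fun i => Set.range (e i)) (Set.range eW) l ε D) :
    DenseSel ε l fun t => eW ⁻¹' D fun i => e i (t i) := by
  intro n t ht
  obtain ⟨hsub, hdens⟩ := hD.2 n _ ((mem_vecLevel_range_iff he).2 ⟨t, ht, rfl⟩)
  refine ⟨fun y hy => heW.mem_level_iff.1 (hsub hy), ?_⟩
  have hb : (0 : ℝ) < bW := Nat.cast_pos.2 (NeZero.pos bW)
  rw [dens, heW.ncard_level, Nat.cast_pow, le_div_iff₀ (by positivity)] at hdens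
  rw [Set.ncard_preimage_of_injective_subset_range heW.injective fun x hx => (hsub hx).1]
  simpa using hdens

/-- The fans of a vector strong subtree above a node of a coded vector tree are coded by fans of
words. -/
theorem exists_fanAt_of_isVecFan {d : ℕ} {b : Fin d → ℕ} {e : ∀ i, List (Fin (b i)) → List ℕ}
    (he : ∀ i, TreeCode (e i)) {n : ℕ} {t : ∀ i, List (Fin (b i))} (ht : HasLength n t)
    {Z F : Fin d → Set (List ℕ)}
    (hZ : IsVecStrongSubtree (fun i => suc (Set.range (e i)) (e i (t i))) Z)
    (hF : IsVecFan Z F) (hroot : IsRoot F fun i => e i (t i)) :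
    ∃ m g, FanAt t m g ∧
      ∀ v, v ∈ vecLevel F 1 ↔ ∃ c : ∀ i, Fin (b i), v = fun i => e i (g i (c i)) := by
  obtain ⟨lZ, hZ⟩ := hZ
  obtain ⟨R, ⟨lR, hR⟩, hFR⟩ := hF
  have hZ' : ∀ i, ∃ ζ, TreeEmb lZ ζ ∧ Z i = Set.range fun u => e i (t i ++ ζ u) := fun i => by
    have := hZ i
    beta_reduce at this
    rw [(he i).suc_range] at this
    exact ((he i).shift (t i)).exists_treeEmb this
  choose ζ hζ hZζ using hZ'
  have hcode : ∀ i, TreeCode fun u => e i (t i ++ ζ i u) := fun i =>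
    ((he i).shift (t i)).comp (hζ i)
  have hR' : ∀ i, ∃ ρ, TreeEmb lR ρ ∧ R i = Set.range fun u => e i (t i ++ ζ i (ρ u)) := fun i =>
    (hcode i).exists_treeEmb (hZζ i ▸ hR i)
  choose ρ hρ hRρ using hR'
  have hcode' : ∀ i, TreeCode fun u => e i (t i ++ ζ i (ρ i u)) := fun i => (hcode i).comp (hρ i)
  have hnil : ∀ i, ζ i (ρ i []) = [] := fun i => by
    have := (hcode' i).mem_level_zero_fan
    rw [← hRρ, ← hFR, hroot i] at this
    simpa using (he i).injective this
  refine ⟨n + lZ (lR 1), fun i c => t i ++ ζ i (ρ i [c]), fun i c => ⟨?_, ?_⟩, fun v => ?_⟩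
  · simp [(hζ i).1, (hρ i).1, ht i]
  · have := ((hζ i).comp (hρ i)).2 [] c
    beta_reduce at this
    rw [hnil] at this
    simpa using this
  · have hv : ∀ i, v i ∈ level (F i) 1 ↔ ∃ c, v i = e i (t i ++ ζ i (ρ i [c])) := fun i => by
      rw [hFR, hRρ, (hcode' i).mem_level_one_fan_iff]
    constructor
    · intro h
      choose c hc using fun i => (hv i).1 (h i)
      exact ⟨c, funext hc⟩
    · rintro ⟨c, rfl⟩ i
      exact (hv i).2 ⟨c i, rfl⟩

/-- Corollary 3.4: a vector strong subtree all of whose nodes carry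
hereditarily strongly correlated data. -/
theorem strongly_correlated_everywhere (d : ℕ) (hd : 1 ≤ d) (hDHL : DHL d)
    (b : Fin d → ℕ) (T : Fin d → Set (List ℕ)) (hT : IsVecHomogeneous b T)
    (bW : ℕ) (W : Set (List ℕ)) (hW : IsHomogeneous bW W)
    (ε : ℝ) (hε0 : 0 < ε) (hε1 : ε ≤ 1)
    (l : ℕ → ℕ) (D : (Fin d → List ℕ) → Set (List ℕ))
    (hD : IsDenseLevelSel T W l ε D) :
    ∃ S : Fin d → Set (List ℕ), IsVecStrongSubtree T S ∧
      ∃ (w : (Fin d → List ℕ) → List ℕ) (θ : (Fin d → List ℕ) → ℝ),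
        ∀ s ∈ levelProd S, w s ∈ W ∧ 0 < θ s ∧ θ s ≤ 1 ∧
          ∀ Z : Fin d → Set (List ℕ),
            IsVecStrongSubtree (fun i => suc (S i) (s i)) Z → IsRoot Z s →
              StronglyCorrelated T W bW l D Z s (w s) (θ s) := by
  have : NeZero d := ⟨by omega⟩
  choose e he hTe using fun i => (hT i).exists_treeCode
  obtain rfl : T = fun i => Set.range (e i) := funext hTe
  obtain ⟨eW, heW, rfl⟩ := hW.exists_treeCode
  have hb : ∀ i, 2 ≤ b i := fun i => (hT i).1
  have hb0 : ∀ i, NeZero (b i) := fun i => ⟨by have := hb i; omega⟩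
  have hbW0 : NeZero bW := ⟨by have := hW.1; omega⟩
  have : Nontrivial (Fin bW) := Fin.nontrivial_iff_two_le.2 hW.1
  have hE := hD.denseSel he heW
  obtain ⟨l', σ, θ, hσ, hθ0, hθ1, hcorr⟩ := exists_treeEmb_relDense hDHL hb hε0 hD.1 hE
  have heσ : ∀ i, TreeCode fun t => e i (σ i t) := fun i => (he i).comp (hσ i)
  refine ⟨fun i => Set.range fun t => e i (σ i t),
    ⟨l', fun i => (he i).isStrongSubtreeWith (hσ i)⟩, ?_⟩
  have hnode : ∀ s ∈ levelProd fun i => Set.range fun t => e i (σ i t), ∃ w, w ∈ Set.range eW ∧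
      ∀ Z : Fin d → Set (List ℕ),
        IsVecStrongSubtree (fun i => suc (Set.range fun t => e i (σ i t)) (s i)) Z → IsRoot Z s →
          StronglyCorrelated (fun i => Set.range (e i)) (Set.range eW) bW l D Z s w θ := by
    intro s hs
    obtain ⟨n, hn⟩ := Set.mem_iUnion.1 hs
    obtain ⟨t, ht, rfl⟩ := (mem_vecLevel_range_iff heσ).1 hn
    obtain ⟨w, hw, hwcorr⟩ := hcorr n t ht
    refine ⟨eW w, ⟨w, rfl⟩, fun Z hZ _ => ⟨hw, fun F hF hroot k hk p hp s hs => ?_⟩⟩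
    obtain rfl := heW.eq_of_isConcat (p := ⟨p, hp⟩) hs
    obtain ⟨m, g, hg, hlev⟩ := exists_fanAt_of_isVecFan heσ ht hZ hF hroot
    obtain rfl : k = l' m := by
      have := (he 0).mem_level_iff.1 (hk ((hlev _).2 ⟨0, rfl⟩) 0)
      rw [← this, (hσ 0).1, (hg 0 _).1]
    have hnm : n < m := by
      have := (hg 0 0).2.length_le
      rw [(hg 0 0).1, List.length_append, ht 0] at this
      exact this
    refine heW.le_densRel ?_ ?_
    · rw [List.length_append, (hE.comp hσ n t ht).1 w hw]
      exact hD.1 ((hσ 0).strictMono hnm)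
    · convert hwcorr m g hg ⟨p, hp⟩ using 1
      ext y
      simp only [Set.mem_preimage, Set.mem_iInter, hlev]
      constructor
      · exact fun h c => h _ ⟨c, rfl⟩
      · rintro h _ ⟨c, rfl⟩
        exact h c
  choose! w hw using hnode
  exact ⟨w, fun _ => θ, fun s hs => ⟨(hw s hs).1, hθ0, hθ1, (hw s hs).2⟩⟩
end DHLPaper
end

section
/- Let d ≥ 1 and assume that DHL(d) holds. Let Z⃗ = (Z_1,…,Z_d) be a vector homogeneous tree, W a homogeneous tree with branching number b_W, 0 < η ≤ 1 and B : ⊗Z⃗ → 2^W an η-dense level selection. Then for every p ∈ {0,…,b_W−1} there exist a vector fan F⃗ of Z⃗ and a node w ∈ B(z⃗_0), where z⃗_0 = F⃗(0), such that ⋂_{z⃗ ∈ ⊗F⃗(1)} B(z⃗) ∩ Suc_W(w⌢_W p) ≠ ∅. -/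
open Filter

namespace DHLPaper

open MeasureTheory

lemma finite_strict_prefixes (T : Set (List ℕ)) (t : List ℕ) :
    {s ∈ T | s <+: t ∧ s ≠ t}.Finite := by
  refine (t.inits.toFinset.finite_toSet).subset fun s hs => ?_
  simpa using hs.2.1

lemma mem_level_zero_iff {T : Set (List ℕ)} {t : List ℕ} :
    t ∈ level T 0 ↔ t ∈ T ∧ ∀ s ∈ T, s <+: t → s = t := by
  simp only [level, Set.mem_ofPred_eq, Set.ncard_eq_zero (finite_strict_prefixes T t),
    Set.eq_empty_iff_forall_notMem]
  refine and_congr_right fun _ => ⟨fun h s hs hst => ?_, fun h s hs => hs.2.2 (h s hs.1 hs.2.1)⟩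
  by_contra hne
  exact h s ⟨hs, hst, hne⟩

lemma strict_prefixes_of_immSuc {T : Set (List ℕ)} {u w : List ℕ} (h : ImmSuc T u w) :
    {s ∈ T | s <+: w ∧ s ≠ w} = insert u {s ∈ T | s <+: u ∧ s ≠ u} := by
  obtain ⟨hu, hw, huw, hne, himm⟩ := h
  ext v
  simp only [Set.mem_ofPred_eq, Set.mem_insert_iff]
  constructor
  · rintro ⟨hv, hvw, hvne⟩
    rcases List.prefix_or_prefix_of_prefix hvw huw with h1 | h1
    · by_cases hvu : v = u
      · exact Or.inl hvu
      · exact Or.inr ⟨hv, h1, hvu⟩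
    · exact Or.inl ((himm v hv h1 hvw).resolve_right hvne)
  · rintro (rfl | ⟨hv, hvu, hvne⟩)
    · exact ⟨hu, huw, hne⟩
    · refine ⟨hv, hvu.trans huw, ?_⟩
      rintro rfl
      exact hvne (hvu.eq_of_length_le huw.length_le)

lemma ImmSuc.mem_level_succ_iff {T : Set (List ℕ)} {u w : List ℕ} (h : ImmSuc T u w) (n : ℕ) :
    w ∈ level T (n + 1) ↔ u ∈ level T n := by
  simp only [level, Set.mem_ofPred_eq, strict_prefixes_of_immSuc h, h.1, h.2.1, true_and]
  rw [Set.ncard_insert_of_notMem (fun hu => hu.2.2 rfl) (finite_strict_prefixes T u)]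
  omega

lemma exists_immSuc_of_mem_level_succ {T : Set (List ℕ)} {w : List ℕ} {n : ℕ}
    (hw : w ∈ level T (n + 1)) : ∃ u ∈ level T n, ImmSuc T u w := by
  have hne : {s ∈ T | s <+: w ∧ s ≠ w}.Nonempty := by
    apply Set.nonempty_of_ncard_ne_zero
    rw [hw.2]
    exact n.succ_ne_zero
  obtain ⟨u, ⟨huT, huw, hune⟩, hmax⟩ :=
    Set.exists_max_image _ List.length (finite_strict_prefixes T w) hne
  have himm : ImmSuc T u w := by
    refine ⟨huT, hw.1, huw, hune, fun v hv huv hvw => ?_⟩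
    by_contra! hcon
    exact hcon.1 (huv.eq_of_length_le (hmax v ⟨hv, hvw, hcon.2⟩)).symm
  exact ⟨u, (himm.mem_level_succ_iff n).1 hw, himm⟩

lemma immSuc_bSeq {b : ℕ} {t : List ℕ} (ht : t ∈ bSeq b) {p : ℕ} (hp : p < b) :
    ImmSuc (bSeq b) t (t ++ [p]) := by
  refine ⟨ht, ?_, List.prefix_append _ _, by simp, fun u _ htu hut => ?_⟩
  · intro x hx
    rcases List.mem_append.1 hx with h | h
    · exact ht x h
    · rw [List.mem_singleton.1 h]
      exact hp
  · rcases List.prefix_concat_iff.1 hut with h | h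
    · exact Or.inr h
    · exact Or.inl (h.eq_of_length_le htu.length_le)

lemma existsUnique_isConcat {b : ℕ} {T : Set (List ℕ)} (hT : IsHomogeneous b T) {t : List ℕ}
    (ht : t ∈ T) {p : ℕ} (hp : p < b) : ∃! s, IsConcat T t p s := by
  obtain ⟨-, k, hsub, -, -, -, hsucc⟩ := hT
  exact hsucc t ht _ (immSuc_bSeq (hsub ht) hp)

lemma ImmSuc.exists_isConcat {b : ℕ} {T : Set (List ℕ)} (hT : T ⊆ bSeq b) {t s : List ℕ}
    (h : ImmSuc T t s) : ∃ p < b, IsConcat T t p s := by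
  obtain ⟨r, rfl⟩ := h.2.2.1
  cases r with
  | nil => exact absurd (List.append_nil t).symm h.2.2.2.1
  | cons p r =>
    exact ⟨p, hT h.2.1 p (by simp), h, by simp⟩

lemma prefix_of_immSuc_chain {T : Set (List ℕ)} {t : ℕ → List ℕ}
    (ht : ∀ n, ImmSuc T (t n) (t (n + 1))) {m n : ℕ} (hmn : m ≤ n) : t m <+: t n := by
  induction n, hmn using Nat.le_induction with
  | base => exact List.prefix_refl _
  | succ n _ ih => exact ih.trans (ht n).2.2.1

/-- A homogeneous tree is coded, level by level, by the sequences of directions. -/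
lemma IsHomogeneous.exists_coding {b : ℕ} {T : Set (List ℕ)} (hT : IsHomogeneous b T) :
    ∃ φ : (ℕ → Fin b) → ℕ → List ℕ,
      (∀ x n, φ x n ∈ level T n) ∧
      (∀ x n, IsConcat T (φ x n) (x n) (φ x (n + 1))) ∧
      (∀ n, ∀ w ∈ level T n, ∃ x, φ x n = w) ∧
      (∀ x y n, φ x n = φ y n ↔ ∀ i < n, x i = y i) := by
  have hb : 0 < b := by have := hT.1; omega
  obtain ⟨r, hr, hr_unique⟩ : UniquelyRooted T := hT.2.choose_spec.2.1
  have hsub : T ⊆ bSeq b := hT.2.choose_spec.1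
  have hstep : ∀ (t : List ℕ) (p : Fin b), ∃ s, t ∈ T → IsConcat T t p s := fun t p => by
    by_cases ht : t ∈ T
    · obtain ⟨s, hs, -⟩ := existsUnique_isConcat hT ht p.2
      exact ⟨s, fun _ => hs⟩
    · exact ⟨t, fun h => absurd h ht⟩
  choose step step_spec using hstep
  let φ : (ℕ → Fin b) → ℕ → List ℕ := fun x n => Nat.rec r (fun k t => step t (x k)) n
  have hlevel : ∀ x n, φ x n ∈ level T n := by
    intro x n
    induction n with
    | zero => exact hr
    | succ n ih => exact ((step_spec (φ x n) (x n) ih.1).1.mem_level_succ_iff n).2 ih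
  have hconcat : ∀ x n, IsConcat T (φ x n) (x n) (φ x (n + 1)) :=
    fun x n => step_spec (φ x n) (x n) (hlevel x n).1
  have hcongr : ∀ x y n, (∀ i < n, x i = y i) → φ x n = φ y n := by
    intro x y n
    induction n with
    | zero => exact fun _ => rfl
    | succ n ih =>
      intro h
      change step (φ x n) (x n) = step (φ y n) (y n)
      rw [ih fun i hi => h i (by omega), h n n.lt_succ_self]
  have hmono : ∀ x m n, m ≤ n → φ x m <+: φ x n := fun x m n =>
    prefix_of_immSuc_chain fun k => (hconcat x k).1
  refine ⟨φ, hlevel, hconcat, ?_, fun x y n => ⟨fun h i => ?_, hcongr x y n⟩⟩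
  · intro n
    induction n with
    | zero => exact fun w hw => ⟨fun _ => ⟨0, hb⟩, (hr_unique w hw).symm⟩
    | succ n ih =>
      intro w hw
      obtain ⟨u, hu, huw⟩ := exists_immSuc_of_mem_level_succ hw
      obtain ⟨x, rfl⟩ := ih u hu
      obtain ⟨p, hp, hpw⟩ := huw.exists_isConcat hsub
      refine ⟨Function.update x n ⟨p, hp⟩, ?_⟩
      have hpre : φ (Function.update x n ⟨p, hp⟩) n = φ x n :=
        hcongr _ _ n fun i hi => Function.update_of_ne hi.ne _ _
      have hc := hconcat (Function.update x n ⟨p, hp⟩) n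
      rw [hpre, Function.update_self] at hc
      exact (existsUnique_isConcat hT hu.1 hp).unique hc hpw
  · induction i using Nat.strong_induction_on with
    | _ i ih =>
      intro hi
      have heq : φ x i = φ y i := hcongr x y i fun j hj => ih j hj (hj.trans hi)
      have hx := (hconcat x i).2.trans (hmono x _ _ hi)
      have hy := (hconcat y i).2.trans (hmono y _ _ hi)
      rw [heq, h] at hx
      have := List.prefix_of_prefix_length_le hx hy (by simp)
      have := this.eq_of_length (by simp)
      simpa [Fin.ext_iff] using this

lemma IsHomogeneous.ncard_level {b : ℕ} {T : Set (List ℕ)} (hT : IsHomogeneous b T) (n : ℕ) :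
    (level T n).ncard = b ^ n := by
  have hb : 0 < b := by have := hT.1; omega
  obtain ⟨φ, hlevel, -, hsurj, hinj⟩ := hT.exists_coding
  let pad : (Fin n → Fin b) → ℕ → Fin b := fun y i => if h : i < n then y ⟨i, h⟩ else ⟨0, hb⟩
  have hrange : level T n = Set.range fun y => φ (pad y) n := by
    refine Set.Subset.antisymm (fun w hw => ?_) (Set.range_subset_iff.2 fun y => hlevel _ n)
    obtain ⟨x, rfl⟩ := hsurj n w hw
    exact ⟨fun i => x i, (hinj _ _ n).2 fun i hi => by simp [pad, hi]⟩
  have hpad : Function.Injective fun y => φ (pad y) n := fun y z h => by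
    funext i
    simpa [pad] using (hinj _ _ n).1 h i i.2
  rw [hrange, ← Nat.card_coe_set_eq, Nat.card_range_of_injective hpad]
  simp

lemma IsHomogeneous.finite_level {b : ℕ} {T : Set (List ℕ)} (hT : IsHomogeneous b T) (n : ℕ) :
    (level T n).Finite := by
  apply Set.finite_of_ncard_ne_zero
  rw [hT.ncard_level]
  exact pow_ne_zero n (by have := hT.1; omega)

lemma IsHomogeneous.nonempty_level {b : ℕ} {T : Set (List ℕ)} (hT : IsHomogeneous b T) (n : ℕ) :
    (level T n).Nonempty := by
  have hb : 0 < b := by have := hT.1; omega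
  obtain ⟨φ, hlevel, -⟩ := hT.exists_coding
  exact ⟨_, hlevel (fun _ => ⟨0, hb⟩) n⟩

lemma IsVecHomogeneous.finite_vecLevel {d : ℕ} {b : Fin d → ℕ} {T : Fin d → Set (List ℕ)}
    (hT : IsVecHomogeneous b T) (n : ℕ) : (vecLevel T n).Finite :=
  Set.Finite.pi' fun i => (hT i).finite_level n

lemma IsVecHomogeneous.nonempty_vecLevel {d : ℕ} {b : Fin d → ℕ} {T : Fin d → Set (List ℕ)}
    (hT : IsVecHomogeneous b T) (n : ℕ) : (vecLevel T n).Nonempty :=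
  ⟨fun i => ((hT i).nonempty_level n).some, fun i => ((hT i).nonempty_level n).some_mem⟩

/-- The two bottom levels of a tree `R` form a tree with the same bottom level. -/
lemma level_zero_fan (R : Set (List ℕ)) :
    level (level R 0 ∪ level R 1) 0 = level R 0 := by
  ext t
  constructor
  · intro ht
    rw [mem_level_zero_iff] at ht
    rcases ht.1 with h | h
    · exact h
    · obtain ⟨u, hu, hut⟩ := exists_immSuc_of_mem_level_succ h
      exact absurd (ht.2 u (Or.inl hu) hut.2.2.1) hut.2.2.2.1
  · intro ht
    refine mem_level_zero_iff.2 ⟨Or.inl ht, fun s hs => (mem_level_zero_iff.1 ht).2 s ?_⟩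
    exact hs.elim And.left And.left

lemma level_one_fan_subset (R : Set (List ℕ)) :
    level (level R 0 ∪ level R 1) 1 ⊆ level R 1 := by
  intro t ht
  refine ht.1.resolve_left fun h => ?_
  rw [← level_zero_fan] at h
  exact absurd (h.2.symm.trans ht.2) (by decide)

/-- If the events `A n v`, for `v` in the finite set `V n`, all have probability at least `c > 0`,
then for some outcome the proportion of those that occur does not tend to zero. -/
lemma exists_limsup_density_pos {Ω ι : Type*} [MeasurableSpace Ω] (μ : Measure Ω)
    [IsProbabilityMeasure μ] (V : ℕ → Set ι) (hfin : ∀ n, (V n).Finite)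
    (hne : ∀ n, (V n).Nonempty) (A : ℕ → ι → Set Ω) {c : ENNReal} (hc : 0 < c)
    (hA : ∀ n, ∀ v ∈ V n, MeasurableSet (A n v)) (hAc : ∀ n, ∀ v ∈ V n, c ≤ μ (A n v)) :
    ∃ x, 0 < limsup (fun n => (({v ∈ V n | x ∈ A n v}.ncard : ℝ) / ((V n).ncard : ℝ))) atTop := by
  classical
  let N : ℕ → Ω → ENNReal :=
    fun n x => (((hfin n).toFinset.card : ENNReal))⁻¹ *
      ∑ v ∈ (hfin n).toFinset, (A n v).indicator 1 x
  have hcard : ∀ n, ((hfin n).toFinset.card : ENNReal) ≠ 0 := fun n => by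
    simpa [Set.nonempty_iff_ne_empty] using hne n
  have hcard' : ∀ n, ((hfin n).toFinset.card : ENNReal) ≠ ⊤ := fun n => ENNReal.natCast_ne_top _
  have hmeas_sum : ∀ n, ∀ v ∈ (hfin n).toFinset,
      Measurable ((A n v).indicator (1 : Ω → ENNReal)) := fun n v hv =>
    measurable_one.indicator (hA n v ((hfin n).mem_toFinset.1 hv))
  have hmeas : ∀ n, Measurable (N n) := fun n =>
    (Finset.measurable_fun_sum _ (hmeas_sum n)).const_mul _
  have hbound : ∀ n x, N n x ≤ 1 := fun n x => by
    calc N n x ≤ (((hfin n).toFinset.card : ENNReal))⁻¹ * ∑ v ∈ (hfin n).toFinset, 1 := by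
          dsimp only [N]
          gcongr
          exact Set.indicator_le_self' (by simp) x
      _ = 1 := by simpa using ENNReal.inv_mul_cancel (hcard n) (hcard' n)
  have hint : ∀ n, c ≤ ∫⁻ x, N n x ∂μ := fun n => by
    rw [lintegral_const_mul _ (Finset.measurable_fun_sum _ (hmeas_sum n)),
      lintegral_finsetSum' _ fun v hv => (hmeas_sum n v hv).aemeasurable]
    calc c = (((hfin n).toFinset.card : ENNReal))⁻¹ * ∑ v ∈ (hfin n).toFinset, c := by
          rw [Finset.sum_const, nsmul_eq_mul, ← mul_assoc,
            ENNReal.inv_mul_cancel (hcard n) (hcard' n), one_mul]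
      _ ≤ _ := by
          gcongr with v hv
          have hv := (hfin n).mem_toFinset.1 hv
          rw [lintegral_indicator_one (hA n v hv)]
          exact hAc n v hv
  have hlim : c ≤ ∫⁻ x, limsup (fun n => N n x) atTop ∂μ :=
    (le_limsup_of_frequently_le' (Frequently.of_forall hint)).trans
      (limsup_lintegral_le 1 hmeas (fun n => ae_of_all _ (hbound n)) (by simp))
  obtain ⟨x, hx⟩ : ∃ x, 0 < limsup (fun n => N n x) atTop := by
    by_contra! h
    have h0 : ∀ x, limsup (fun n => N n x) atTop = 0 := fun x => le_antisymm (h x) bot_le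
    simp only [h0, lintegral_zero] at hlim
    exact absurd hc hlim.not_gt
  refine ⟨x, ?_⟩
  have hN : ∀ n, N n x = ENNReal.ofReal
      (({v ∈ V n | x ∈ A n v}.ncard : ℝ) / ((V n).ncard : ℝ)) := fun n => by
    have hsum : ∑ v ∈ (hfin n).toFinset, (A n v).indicator (1 : Ω → ENNReal) x =
        {v ∈ V n | x ∈ A n v}.ncard := by
      rw [Set.ncard_eq_toFinset_card _ ((hfin n).subset fun v hv => hv.1)]
      simp only [Set.indicator_apply, Pi.one_apply, Finset.sum_boole]
      congr 2
      ext v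
      simp
    have hpos : (0 : ℝ) < (V n).ncard := by exact_mod_cast (Set.ncard_pos (hfin n)).2 (hne n)
    rw [ENNReal.ofReal_div_of_pos hpos, ENNReal.ofReal_natCast, ENNReal.ofReal_natCast,
      ENNReal.div_eq_inv_mul, Set.ncard_eq_toFinset_card _ (hfin n)]
    simp only [N, hsum]
  obtain ⟨r, hr0, hr⟩ := ENNReal.lt_iff_exists_nnreal_btwn.1 hx
  have hr0 : (0 : ℝ) < r := by exact_mod_cast hr0
  refine hr0.trans_le (le_limsup_of_frequently_le ?_ ?_)
  · refine (frequently_lt_of_lt_limsup (by isBoundedDefault) hr).mono fun n hn => ?_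
    rw [hN] at hn
    exact (ENNReal.ofReal_lt_ofReal_iff'.1 (by simpa using hn)).1.le
  · refine isBoundedUnder_of ⟨1, fun n => ?_⟩
    have := hbound n x
    rw [hN] at this
    exact ENNReal.ofReal_le_one.1 this

/-- The measure on the branches of a homogeneous tree induced by the densities of its levels. -/
lemma IsHomogeneous.exists_measure {b : ℕ} {T : Set (List ℕ)} (hT : IsHomogeneous b T)
    {φ : (ℕ → Fin b) → ℕ → List ℕ} (hsurj : ∀ n, ∀ w ∈ level T n, ∃ x, φ x n = w)
    (hinj : ∀ x y n, φ x n = φ y n ↔ ∀ i < n, x i = y i) :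
    ∃ μ : Measure (ℕ → Fin b), IsProbabilityMeasure μ ∧
      ∀ n, ∀ F ⊆ level T n, ∀ p : Fin b, MeasurableSet {x | φ x n ∈ F ∧ x n = p} ∧
        μ {x | φ x n ∈ F ∧ x n = p} = ENNReal.ofReal (dens T n F / b) := by
  have hb : 0 < b := by have := hT.1; omega
  have : Nonempty (Fin b) := ⟨⟨0, hb⟩⟩
  let μ : Measure (ℕ → Fin b) :=
    Measure.infinitePi fun _ => ProbabilityTheory.uniformOn (Set.univ : Set (Fin b))
  refine ⟨μ, inferInstance, fun n F hF p => ?_⟩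
  have hFfin : F.Finite := (hT.finite_level n).subset hF
  have hcyl : ∀ w ∈ F, MeasurableSet {x | φ x n = w ∧ x n = p} ∧
      μ {x | φ x n = w ∧ x n = p} = ((b : ENNReal) ^ (n + 1))⁻¹ := fun w hw => by
    obtain ⟨y, rfl⟩ := hsurj n w (hF hw)
    have heq : {x | φ x n = φ y n ∧ x n = p} = Set.pi (Finset.range (n + 1) : Set ℕ)
        fun i => {Function.update y n p i} := by
      ext x
      simp only [Set.mem_ofPred_eq, hinj, Set.mem_pi, Finset.mem_coe, Finset.mem_range,
        Set.mem_singleton_iff, Nat.lt_succ_iff_lt_or_eq, or_imp, forall_and, forall_eq,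
        Function.update_self]
      refine and_congr_left fun _ => forall₂_congr fun i hi => ?_
      rw [Function.update_of_ne hi.ne]
    rw [heq]
    refine ⟨MeasurableSet.pi (Finset.countable_toSet _) fun i _ => measurableSet_singleton _, ?_⟩
    rw [Measure.infinitePi_pi _ fun i _ => measurableSet_singleton _]
    simp [ProbabilityTheory.uniformOn_univ, ENNReal.inv_pow]
  have hunion : {x | φ x n ∈ F ∧ x n = p} = ⋃ w ∈ hFfin.toFinset, {x | φ x n = w ∧ x n = p} := by
    ext x
    simp
  rw [hunion]
  refine ⟨Finset.measurableSet_biUnion _ fun w hw => (hcyl w (hFfin.mem_toFinset.1 hw)).1, ?_⟩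
  rw [measure_biUnion_finset ?_ fun w hw => (hcyl w (hFfin.mem_toFinset.1 hw)).1]
  · rw [Finset.sum_congr rfl fun w hw => (hcyl w (hFfin.mem_toFinset.1 hw)).2, Finset.sum_const,
      ← Set.ncard_eq_toFinset_card F hFfin, dens, hT.ncard_level, div_div, nsmul_eq_mul,
      ENNReal.ofReal_div_of_pos (by positivity), ENNReal.ofReal_natCast, ENNReal.div_eq_inv_mul,
      mul_comm]
    congr 2
    exact_mod_cast (ENNReal.ofReal_natCast (b ^ (n + 1))).symm
  · intro w _ w' _ hne
    exact Set.disjoint_left.2 fun x hx hx' => hne (hx.1.symm.trans hx'.1)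

/-- Proposition 3.5: in every direction `p`, some vector fan has a
nonempty common intersection above `w ⌢_W p` for some `w ∈ B(F(0))`. -/
theorem fan_intersection_nonempty (d : ℕ) (hd : 1 ≤ d) (hDHL : DHL d)
    (b : Fin d → ℕ) (Z : Fin d → Set (List ℕ)) (hZ : IsVecHomogeneous b Z)
    (bW : ℕ) (W : Set (List ℕ)) (hW : IsHomogeneous bW W)
    (η : ℝ) (hη0 : 0 < η) (hη1 : η ≤ 1)
    (l : ℕ → ℕ) (B : (Fin d → List ℕ) → Set (List ℕ))
    (hB : IsDenseLevelSel Z W l η B) :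
    ∀ p < bW, ∃ (F : Fin d → Set (List ℕ)) (z0 : Fin d → List ℕ),
      IsVecFan Z F ∧ IsRoot F z0 ∧
        ∃ w ∈ B z0, ∃ s, IsConcat W w p s ∧
          ((⋂ z ∈ vecLevel F 1, B z) ∩ suc W s).Nonempty := by
  intro p hp
  obtain ⟨φ, hlevel, hconcat, hsurj, hinj⟩ := hW.exists_coding
  obtain ⟨μ, _, hμ⟩ := hW.exists_measure hsurj hinj
  have hbW : (0 : ℝ) < bW := by exact_mod_cast (Nat.zero_le p).trans_lt hp
  let A : ℕ → (Fin d → List ℕ) → Set (ℕ → Fin bW) :=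
    fun n v => {x | φ x (l n) ∈ B v ∧ x (l n) = ⟨p, hp⟩}
  obtain ⟨x, hx⟩ := exists_limsup_density_pos μ (vecLevel Z) hZ.finite_vecLevel
    hZ.nonempty_vecLevel A (c := ENNReal.ofReal (η / bW)) (ENNReal.ofReal_pos.2 (by positivity))
    (fun n v hv => (hμ (l n) (B v) (hB.2 n v hv).1 ⟨p, hp⟩).1) (fun n v hv => by
      rw [(hμ (l n) (B v) (hB.2 n v hv).1 ⟨p, hp⟩).2]
      have := (hB.2 n v hv).2
      gcongr)
  have hlevel_inj : ∀ m n v, v ∈ vecLevel Z m → v ∈ vecLevel Z n → m = n := fun m n v hm hn =>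
    (hm ⟨0, hd⟩).2.symm.trans (hn ⟨0, hd⟩).2
  let D : Set (Fin d → List ℕ) := {v | ∃ n, v ∈ vecLevel Z n ∧ x ∈ A n v}
  have hD : ∀ n, D ∩ vecLevel Z n = {v ∈ vecLevel Z n | x ∈ A n v} := fun n => by
    ext v
    constructor
    · rintro ⟨⟨m, hm, hxm⟩, hn⟩
      obtain rfl := hlevel_inj m n v hm hn
      exact ⟨hn, hxm⟩
    · exact fun h => ⟨⟨n, h⟩, h.1⟩
  obtain ⟨S, ⟨k, hS⟩, hSD⟩ := hDHL b Z hZ D (fun v ⟨n, hn, _⟩ => Set.mem_iUnion.2 ⟨n, hn⟩)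
    (by simpa only [hD] using hx)
  have hSA : ∀ n, ∀ v ∈ vecLevel S n, x ∈ A (k n) v := fun n v hv => by
    have hvD : v ∈ D ∩ vecLevel Z (k n) :=
      ⟨hSD (Set.mem_iUnion.2 ⟨n, hv⟩), fun i => (hS i).2.2.2.1 n (hv i)⟩
    rw [hD] at hvD
    exact hvD.2
  choose z0 hz0 hz0_unique using fun i => (hS i).2.1
  have hroot := hSA 0 z0 hz0
  refine ⟨fun i => level (S i) 0 ∪ level (S i) 1, z0, ⟨S, ⟨k, hS⟩, fun _ => rfl⟩, fun i => ?_,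
    φ x (l (k 0)), hroot.1, φ x (l (k 0) + 1), ?_, φ x (l (k 1)), ?_, (hlevel x _).1, ?_⟩
  · rw [level_zero_fan]
    exact Set.eq_singleton_iff_unique_mem.2 ⟨hz0 i, hz0_unique i⟩
  · have := hconcat x (l (k 0))
    rwa [hroot.2] at this
  · exact Set.mem_iInter₂.2 fun z hz => (hSA 1 z fun i => level_one_fan_subset _ (hz i)).1
  · exact prefix_of_immSuc_chain (fun n => (hconcat x n).1)
      (hB.1 ((hS ⟨0, hd⟩).2.2.1 Nat.zero_lt_one))
end DHLPaper
end
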